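/- arXiv:1302.0639 — 2 statements merged into one kernel-verified Lean document; each statement's English description precedes it below -/
import Mathlib

section
/- Assume k ≥ 2. Let T ⊆ ker D be the union of the following six families: (1) f_{i,j} for 1 ≤ j ≤ k and 0 ≤ i ≤ ⌊n_j/2⌋; (2) ε_{s_{i₂,j₂}}(x_{i₁,j₁}) for 1 ≤ j₁ < j₂ ≤ k, ⌊(n_{j₁}−1)/2⌋ < i₁ ≤ n_{j₁}, and 0 ≤ i₂ ≤ ⌊(n_{j₂}−1)/2⌋; (3) ε_{s_{i₂,j}}(x_{i₁,j}) for 1 ≤ j ≤ k, 0 ≤ i₂ ≤ ⌊(n_j−1)/2⌋, and i₂ ≤ i₁ ≤ n_j; (4) ε_{s_{i₂,j₂}}(x_{i₁,j₁}) for 1 ≤ j₂ < j₁ ≤ k, 0 ≤ i₁ ≤ n_{j₁}, and 0 ≤ i₂ ≤ ⌊(n_{j₂}−1)/2⌋; (5) w_{j₁,j₂} for 1 ≤ j₁ ≠ j₂ ≤ l′; (6) z_j for l′ < j ≤ l. Then T is a separating set for ker D: for all points v, w ∈ V such that f(v) ≠ f(w) for some f ∈ ker D, there exists t ∈ T with t(v)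 ≠ t(w). -/
open MvPolynomial Finset

variable (𝕜 : Type) [Field 𝕜] [CharZero 𝕜] (k : ℕ) (n : Fin k → ℕ)

/-- The variable `x_{i,j}` (as `X ⟨j,i⟩`), or `0` if `i` is out of range. -/
noncomputable def Xv (j : Fin k) (i : ℕ) : MvPolynomial (Σ j : Fin k, Fin (n j + 1)) 𝕜 :=
  if h : i ≤ n j then MvPolynomial.X ⟨j, ⟨i, Nat.lt_succ_of_le h⟩⟩ else 0

/-- The Weitzenböck derivation `D` with `D x_{0,j} = 0` and `D x_{i,j} = x_{i-1,j}`. -/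
noncomputable def Dw : Derivation 𝕜 (MvPolynomial (Σ j : Fin k, Fin (n j + 1)) 𝕜)
    (MvPolynomial (Σ j : Fin k, Fin (n j + 1)) 𝕜) :=
  mkDerivation 𝕜 fun v => if (v.2 : ℕ) = 0 then 0 else Xv 𝕜 k n v.1 ((v.2 : ℕ) - 1)

/-- The invariants `f_{i,j}`. -/
noncomputable def fP (j : Fin k) (i : ℕ) : MvPolynomial (Σ j : Fin k, Fin (n j + 1)) 𝕜 :=
  if i = 0 then Xv 𝕜 k n j 0
  else (∑ q ∈ Finset.range i, C ((-1 : 𝕜) ^ q) * Xv 𝕜 k n j q * Xv 𝕜 k n j (2 * i - q))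
    + C ((-1 : 𝕜) ^ i / 2) * Xv 𝕜 k n j i ^ 2

/-- The local slices `s_{i,j}`. -/
noncomputable def sP (j : Fin k) (i : ℕ) : MvPolynomial (Σ j : Fin k, Fin (n j + 1)) 𝕜 :=
  if i = 0 then Xv 𝕜 k n j 1
  else ∑ q ∈ Finset.range (i + 1),
    C ((-1 : 𝕜) ^ q * ((2 * i + 1 - 2 * q : ℕ) : 𝕜) / 2) * Xv 𝕜 k n j q * Xv 𝕜 k n j (2 * i + 1 - q)

/-- `ε_s(f) = ∑_{q=0}^{ν} ((-1)^q/q!) (D^q f) s^q (D s)^{ν - q}`. -/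
noncomputable def eps (s f : MvPolynomial (Σ j : Fin k, Fin (n j + 1)) 𝕜) (ν : ℕ) :
    MvPolynomial (Σ j : Fin k, Fin (n j + 1)) 𝕜 :=
  ∑ q ∈ Finset.range (ν + 1),
    C ((-1 : 𝕜) ^ q / (q.factorial : 𝕜)) * ((⇑(Dw 𝕜 k n))^[q] f) * s ^ q *
      (Dw 𝕜 k n s) ^ (ν - q)

/-- The derivation `Δ_j` with `Δ_j x_{i,j} = (n_j - i)(i+1) x_{i+1,j}`. -/
noncomputable def Δw (j : Fin k) : Derivation 𝕜 (MvPolynomial (Σ j : Fin k, Fin (n j + 1)) 𝕜)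
    (MvPolynomial (Σ j : Fin k, Fin (n j + 1)) 𝕜) :=
  mkDerivation 𝕜 fun v =>
    if v.1 = j then C ((((n v.1 - (v.2 : ℕ)) * ((v.2 : ℕ) + 1) : ℕ)) : 𝕜) * Xv 𝕜 k n v.1 ((v.2 : ℕ) + 1)
    else 0

/-- The semitransvectant `w_{j₁,j₂}`. -/
noncomputable def wP (j1 j2 : Fin k) : MvPolynomial (Σ j : Fin k, Fin (n j + 1)) 𝕜 :=
  ∑ q ∈ Finset.range (Nat.lcm (n j1) (n j2) + 1),
    C ((-1 : 𝕜) ^ q * ((Nat.lcm (n j1) (n j2)).factorial : 𝕜)) *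
      ((⇑(Δw 𝕜 k n j1))^[Nat.lcm (n j1) (n j2) - q] (Xv 𝕜 k n j1 0 ^ (Nat.lcm (n j1) (n j2) / n j1))) *
      ((⇑(Δw 𝕜 k n j2))^[q] (Xv 𝕜 k n j2 0 ^ (Nat.lcm (n j1) (n j2) / n j2)))

/-- The semitransvectant `z_j`. -/
noncomputable def zP (j : Fin k) : MvPolynomial (Σ j : Fin k, Fin (n j + 1)) 𝕜 :=
  ∑ q ∈ Finset.range (n j + 1),
    C ((-1 : 𝕜) ^ q * ((n j).factorial : 𝕜)) *
      ((⇑(Δw 𝕜 k n j))^[n j - q] (Xv 𝕜 k n j 0)) *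
      ((⇑(Δw 𝕜 k n j))^[q] (fP 𝕜 k n j (n j / 4)))

set_option linter.unusedSectionVars false

section

variable {𝕜 k n}

theorem Xv_of_le {j : Fin k} {i : ℕ} (h : i ≤ n j) :
    Xv 𝕜 k n j i = X ⟨j, ⟨i, Nat.lt_succ_of_le h⟩⟩ := dif_pos h

theorem Xv_fin (x : Σ j : Fin k, Fin (n j + 1)) : Xv 𝕜 k n x.1 x.2 = X x :=
  Xv_of_le (Nat.le_of_lt_succ x.2.2)

theorem Dw_Xv_zero (j : Fin k) : Dw 𝕜 k n (Xv 𝕜 k n j 0) = 0 := by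
  rw [Xv_of_le (Nat.zero_le _), Dw, mkDerivation_X]
  simp

theorem Dw_Xv_succ {j : Fin k} {i : ℕ} (h : i + 1 ≤ n j) :
    Dw 𝕜 k n (Xv 𝕜 k n j (i + 1)) = Xv 𝕜 k n j i := by
  rw [Xv_of_le h, Dw, mkDerivation_X]
  simp

theorem Dw_iterate_Xv {j : Fin k} {i : ℕ} (h : i ≤ n j) {q : ℕ} (hq : q ≤ i) :
    (⇑(Dw 𝕜 k n))^[q] (Xv 𝕜 k n j i) = Xv 𝕜 k n j (i - q) := by
  induction q with
  | zero => simp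
  | succ q ih =>
    rw [Function.iterate_succ_apply', ih (by omega),
      show i - q = i - (q + 1) + 1 by omega, Dw_Xv_succ (by omega)]

theorem Dw_iterate_succ_Xv {j : Fin k} {i : ℕ} (h : i ≤ n j) :
    (⇑(Dw 𝕜 k n))^[i + 1] (Xv 𝕜 k n j i) = 0 := by
  rw [Function.iterate_succ_apply', Dw_iterate_Xv h le_rfl, Nat.sub_self, Dw_Xv_zero]

theorem derivation_map_C_mul (E : Derivation 𝕜 (MvPolynomial (Σ j : Fin k, Fin (n j + 1)) 𝕜)
    (MvPolynomial (Σ j : Fin k, Fin (n j + 1)) 𝕜)) (c : 𝕜)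
    (p : MvPolynomial (Σ j : Fin k, Fin (n j + 1)) 𝕜) : E (C c * p) = C c * E p := by
  rw [← smul_eq_C_mul, ← smul_eq_C_mul, E.map_smul]

/-- The invariants `f_{i,j}` lie in `ker D`. -/
theorem Dw_fP {j : Fin k} {i : ℕ} (h : 2 * i ≤ n j) : Dw 𝕜 k n (fP 𝕜 k n j i) = 0 := by
  rcases i with _ | i
  · simpa [fP] using Dw_Xv_zero j
  let G : ℕ → MvPolynomial (Σ j : Fin k, Fin (n j + 1)) 𝕜 := fun q =>
    if q = 0 then 0 else C ((-1 : 𝕜) ^ q) * Xv 𝕜 k n j (q - 1) * Xv 𝕜 k n j (2 * (i + 1) - q)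
  have hsum : Dw 𝕜 k n (∑ q ∈ Finset.range (i + 1),
      C ((-1 : 𝕜) ^ q) * Xv 𝕜 k n j q * Xv 𝕜 k n j (2 * (i + 1) - q)) = G 0 - G (i + 1) := by
    rw [map_sum, ← Finset.sum_range_sub']
    refine Finset.sum_congr rfl fun q hq => ?_
    rw [Finset.mem_range] at hq
    have e : Dw 𝕜 k n (Xv 𝕜 k n j (2 * (i + 1) - q)) = Xv 𝕜 k n j (2 * (i + 1) - (q + 1)) := by
      rw [show 2 * (i + 1) - q = 2 * (i + 1) - (q + 1) + 1 by omega, Dw_Xv_succ (by omega)]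
    rw [mul_assoc, derivation_map_C_mul, Derivation.leibniz, e]
    rcases q with _ | q
    · simp [G, Dw_Xv_zero]
    · rw [Dw_Xv_succ (by omega)]
      simp only [G, smul_eq_mul, Nat.add_eq_zero_iff, one_ne_zero, and_false, if_false,
        Nat.add_sub_cancel, pow_succ, map_mul, map_neg, map_one]
      ring
  have e2 : 2 * (i + 1) - (i + 1) = i + 1 := by omega
  rw [fP, if_neg (Nat.succ_ne_zero i), map_add, hsum, derivation_map_C_mul, Derivation.leibniz_pow,
    Dw_Xv_succ (by omega)]
  have e3 : (C ((-1 : 𝕜) ^ (i + 1)) : MvPolynomial (Σ j : Fin k, Fin (n j + 1)) 𝕜)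
      = C ((-1 : 𝕜) ^ (i + 1) / 2) * 2 := by
    rw [← map_ofNat C 2, ← map_mul]; congr 1; ring
  simp only [G, e2, if_neg (Nat.succ_ne_zero i), if_true, e3, Nat.add_sub_cancel, nsmul_eq_mul,
    smul_eq_mul]
  push_cast
  ring

/-- `s_{i,j}` is a local slice: `D s_{i,j} = f_{i,j}`. -/
theorem Dw_sP {j : Fin k} {i : ℕ} (h : 2 * i + 1 ≤ n j) :
    Dw 𝕜 k n (sP 𝕜 k n j i) = fP 𝕜 k n j i := by
  rcases i with _ | i
  · simpa [sP, fP] using Dw_Xv_succ (𝕜 := 𝕜) (i := 0) (by simpa using h)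
  let G : ℕ → MvPolynomial (Σ j : Fin k, Fin (n j + 1)) 𝕜 := fun q =>
    if q = 0 then 0 else C ((-1 : 𝕜) ^ q * (2 * (i + 1) + 1 - 2 * q) / 2) * Xv 𝕜 k n j (q - 1)
      * Xv 𝕜 k n j (2 * (i + 1) + 1 - q)
  have key : ∀ q ∈ Finset.range (i + 1 + 1), Dw 𝕜 k n
      (C ((-1 : 𝕜) ^ q * ((2 * (i + 1) + 1 - 2 * q : ℕ) : 𝕜) / 2) * Xv 𝕜 k n j q
        * Xv 𝕜 k n j (2 * (i + 1) + 1 - q)) =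
      (G q - G (q + 1)) + C ((-1 : 𝕜) ^ q) * Xv 𝕜 k n j q * Xv 𝕜 k n j (2 * (i + 1) - q) := by
    intro q hq
    rw [Finset.mem_range] at hq
    have e : Dw 𝕜 k n (Xv 𝕜 k n j (2 * (i + 1) + 1 - q)) = Xv 𝕜 k n j (2 * (i + 1) - q) := by
      rw [show 2 * (i + 1) + 1 - q = 2 * (i + 1) - q + 1 by omega, Dw_Xv_succ (by omega)]
    have e' : 2 * (i + 1) + 1 - (q + 1) = 2 * (i + 1) - q := by omega
    have e4 : (C ((-1 : 𝕜) ^ q * (2 * (i + 1) + 1 - 2 * q) / 2) :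
        MvPolynomial (Σ j : Fin k, Fin (n j + 1)) 𝕜)
        = C ((-1 : 𝕜) ^ q) - C ((-1 : 𝕜) ^ (q + 1) * (2 * (i + 1) + 1 - 2 * (q + 1 : ℕ)) / 2) := by
      rw [← map_sub]; congr 1; push_cast; ring
    have hc : ((2 * (i + 1) + 1 - 2 * q : ℕ) : 𝕜) = 2 * ((i : 𝕜) + 1) + 1 - 2 * q := by
      rw [Nat.cast_sub (by omega)]; push_cast; ring
    rw [hc, mul_assoc, derivation_map_C_mul, Derivation.leibniz, e]
    rcases q with _ | q
    · simp only [G, if_true, if_neg (Nat.succ_ne_zero _), e', smul_eq_mul, Dw_Xv_zero, mul_zero,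
        add_zero, zero_sub]
      rw [e4]
      simp only [Nat.sub_zero, Nat.add_sub_cancel]
      ring
    · rw [Dw_Xv_succ (by omega)]
      simp only [G, if_neg (Nat.succ_ne_zero _), e', smul_eq_mul, Nat.add_sub_cancel]
      rw [e4]
      ring
  have e2 : 2 * (i + 1) - (i + 1) = i + 1 := by omega
  have e5 : 2 * (i + 1) + 1 - (i + 1 + 1) = i + 1 := by omega
  rw [sP, if_neg (Nat.succ_ne_zero i), fP, if_neg (Nat.succ_ne_zero i), map_sum,
    Finset.sum_congr rfl key, Finset.sum_add_distrib, Finset.sum_range_sub', Finset.sum_range_succ,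
    e2]
  have e6 : (C ((-1 : 𝕜) ^ (i + 1 + 1) * (2 * (i + 1) + 1 - 2 * (i + 1 + 1 : ℕ)) / 2) :
      MvPolynomial (Σ j : Fin k, Fin (n j + 1)) 𝕜) = C ((-1 : 𝕜) ^ (i + 1) / 2) := by
    congr 1; push_cast; ring
  have e7 : (C ((-1 : 𝕜) ^ (i + 1)) : MvPolynomial (Σ j : Fin k, Fin (n j + 1)) 𝕜)
      = C ((-1 : 𝕜) ^ (i + 1) / 2) * 2 := by
    rw [← map_ofNat C 2, ← map_mul]; congr 1; ring
  simp only [G, if_true, if_neg (Nat.succ_ne_zero _), e5, e6, e7, Nat.add_sub_cancel]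
  ring

theorem Dw_eps {s f : MvPolynomial (Σ j : Fin k, Fin (n j + 1)) 𝕜} {ν : ℕ}
    (hs : Dw 𝕜 k n (Dw 𝕜 k n s) = 0) (hf : (⇑(Dw 𝕜 k n))^[ν + 1] f = 0) :
    Dw 𝕜 k n (eps 𝕜 k n s f ν) = 0 := by
  let G : ℕ → MvPolynomial (Σ j : Fin k, Fin (n j + 1)) 𝕜 := fun q =>
    C ((-1 : 𝕜) ^ q / (q.factorial : 𝕜) * q) * ((⇑(Dw 𝕜 k n))^[q] f) * s ^ (q - 1) *
      (Dw 𝕜 k n s) ^ (ν + 1 - q)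
  have key : ∀ q ∈ Finset.range (ν + 1), Dw 𝕜 k n
      (C ((-1 : 𝕜) ^ q / (q.factorial : 𝕜)) * ((⇑(Dw 𝕜 k n))^[q] f) * s ^ q *
        (Dw 𝕜 k n s) ^ (ν - q)) = G q - G (q + 1) := by
    intro q hq
    rw [Finset.mem_range] at hq
    have e1 : (C ((-1 : 𝕜) ^ (q + 1) / ((q + 1).factorial : 𝕜) * (q + 1 : ℕ)) :
        MvPolynomial (Σ j : Fin k, Fin (n j + 1)) 𝕜) = - C ((-1 : 𝕜) ^ q / (q.factorial : 𝕜)) := by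
      rw [← map_neg]
      congr 1
      have h1 : (q.factorial : 𝕜) ≠ 0 := by exact_mod_cast q.factorial_ne_zero
      have h2 : ((q : 𝕜) + 1) ≠ 0 := by exact_mod_cast q.succ_ne_zero
      rw [Nat.factorial_succ]
      push_cast
      field_simp
      ring
    have e2 : ν + 1 - q = (ν - q) + 1 := by omega
    have e3 : ν + 1 - (q + 1) = ν - q := by omega
    simp only [G, e1, e2, e3, Nat.add_sub_cancel]
    rw [mul_assoc, mul_assoc, derivation_map_C_mul, Derivation.leibniz, Derivation.leibniz,
      Derivation.leibniz_pow, Derivation.leibniz_pow, hs, Function.iterate_succ_apply', map_mul,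
      map_natCast]
    simp only [smul_eq_mul, nsmul_eq_mul, mul_zero, pow_succ]
    ring
  rw [eps, map_sum, Finset.sum_congr rfl key, Finset.sum_range_sub']
  simp [G, hf]

theorem Dw_eps_sP_Xv {j₁ j₂ : Fin k} {i₁ i₂ : ℕ} (h₁ : i₁ ≤ n j₁) (h₂ : 2 * i₂ + 1 ≤ n j₂) :
    Dw 𝕜 k n (eps 𝕜 k n (sP 𝕜 k n j₂ i₂) (Xv 𝕜 k n j₁ i₁) i₁) = 0 :=
  Dw_eps (by rw [Dw_sP h₂, Dw_fP (by omega)]) (Dw_iterate_succ_Xv h₁)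

/-- The weight derivation `H_j`, the commutator of `D` and `Δ_j`. -/
noncomputable def weightDer (j : Fin k) :
    Derivation 𝕜 (MvPolynomial (Σ j : Fin k, Fin (n j + 1)) 𝕜)
      (MvPolynomial (Σ j : Fin k, Fin (n j + 1)) 𝕜) :=
  mkDerivation 𝕜 fun x => if x.1 = j then C ((n x.1 : 𝕜) - 2 * (x.2 : ℕ)) * X x else 0

theorem weightDer_Xv {j : Fin k} {i : ℕ} (h : i ≤ n j) :
    weightDer j (Xv 𝕜 k n j i) = C ((n j : 𝕜) - 2 * i) * Xv 𝕜 k n j i := by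
  rw [Xv_of_le h, weightDer, mkDerivation_X]
  simp

theorem Δw_Xv {j : Fin k} {i : ℕ} (h : i ≤ n j) :
    Δw 𝕜 k n j (Xv 𝕜 k n j i)
      = C ((((n j - i) * (i + 1) : ℕ)) : 𝕜) * Xv 𝕜 k n j (i + 1) := by
  rw [Xv_of_le h, Δw, mkDerivation_X]
  simp

theorem Δw_Xv_of_ne {j j' : Fin k} (hj : j' ≠ j) (i : ℕ) :
    Δw 𝕜 k n j (Xv 𝕜 k n j' i) = 0 := by
  by_cases h : i ≤ n j'
  · rw [Xv_of_le h, Δw, mkDerivation_X]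
    simp [hj]
  · rw [Xv, dif_neg h, map_zero]

theorem weightDer_Xv_of_ne {j j' : Fin k} (hj : j' ≠ j) (i : ℕ) :
    weightDer j (Xv 𝕜 k n j' i) = 0 := by
  by_cases h : i ≤ n j'
  · rw [Xv_of_le h, weightDer, mkDerivation_X]
    simp [hj]
  · rw [Xv, dif_neg h, map_zero]

theorem lie_Dw_Δw (j : Fin k) : ⁅Dw 𝕜 k n, Δw 𝕜 k n j⁆ = weightDer j := by
  refine MvPolynomial.derivation_ext fun x => ?_
  rw [Derivation.commutator_apply, ← Xv_fin x]
  obtain ⟨j', i, hi⟩ := x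
  have hi : i ≤ n j' := Nat.le_of_lt_succ hi
  simp only
  by_cases hj : j' = j
  · subst hj
    rw [Δw_Xv hi, weightDer_Xv hi, derivation_map_C_mul]
    have e : C ((((n j' - i) * (i + 1) : ℕ)) : 𝕜) * Dw 𝕜 k n (Xv 𝕜 k n j' (i + 1))
        = C ((((n j' - i) * (i + 1) : ℕ)) : 𝕜) * Xv 𝕜 k n j' i := by
      rcases hi.lt_or_eq with h | h
      · rw [Dw_Xv_succ h]
      · simp [← h]
    rw [e]
    rcases i with _ | i
    · rw [Dw_Xv_zero]; simp
    · rw [Dw_Xv_succ hi, Δw_Xv (by omega), ← sub_mul, ← map_sub]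
      congr 2
      push_cast [Nat.cast_sub hi, Nat.cast_sub (show i ≤ n j' by omega)]
      ring
  · rw [Δw_Xv_of_ne hj, weightDer_Xv_of_ne hj, map_zero, zero_sub, neg_eq_zero]
    rcases i with _ | i
    · rw [Dw_Xv_zero, map_zero]
    · rw [Dw_Xv_succ hi, Δw_Xv_of_ne hj]

theorem lie_weightDer_Δw (j : Fin k) :
    ⁅(weightDer j : Derivation 𝕜 (MvPolynomial (Σ j : Fin k, Fin (n j + 1)) 𝕜) _), Δw 𝕜 k n j⁆
      = (-2 : 𝕜) • Δw 𝕜 k n j := by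
  refine MvPolynomial.derivation_ext fun x => ?_
  rw [Derivation.commutator_apply, ← Xv_fin x]
  obtain ⟨j', i, hi⟩ := x
  have hi : i ≤ n j' := Nat.le_of_lt_succ hi
  simp only [Derivation.smul_apply]
  by_cases hj : j' = j
  · subst hj
    rw [Δw_Xv hi, weightDer_Xv hi, derivation_map_C_mul, derivation_map_C_mul, Δw_Xv hi]
    rcases hi.lt_or_eq with h | h
    · rw [weightDer_Xv h, smul_eq_C_mul]
      have e : (C ((n j' : 𝕜) - 2 * (i + 1 : ℕ)) : MvPolynomial (Σ j : Fin k, Fin (n j + 1)) 𝕜)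
          = C ((n j' : 𝕜) - 2 * i) + C (-2) := by
        rw [← map_add]; congr 1; push_cast; ring
      rw [e]
      ring
    · simp [← h]
  · rw [Δw_Xv_of_ne hj, weightDer_Xv_of_ne hj]
    simp

theorem weightDer_iterate_Δw {j : Fin k} {f : MvPolynomial (Σ j : Fin k, Fin (n j + 1)) 𝕜}
    {N : 𝕜} (hH : weightDer j f = C N * f) (q : ℕ) :
    weightDer j ((⇑(Δw 𝕜 k n j))^[q] f) = C (N - 2 * q) * (⇑(Δw 𝕜 k n j))^[q] f := by
  induction q with
  | zero => simpa using hH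
  | succ q ih =>
    have h := congrArg (fun E => E ((⇑(Δw 𝕜 k n j))^[q] f)) (lie_weightDer_Δw (𝕜 := 𝕜) (n := n) j)
    simp only [Derivation.commutator_apply, Derivation.smul_apply] at h
    rw [ih, derivation_map_C_mul, sub_eq_iff_eq_add, smul_eq_C_mul, ← add_mul, ← map_add] at h
    rw [Function.iterate_succ_apply', h]
    congr 2
    push_cast
    ring

theorem Dw_iterate_Δw {j : Fin k} {f : MvPolynomial (Σ j : Fin k, Fin (n j + 1)) 𝕜}
    {N : 𝕜} (hD : Dw 𝕜 k n f = 0) (hH : weightDer j f = C N * f) (q : ℕ) :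
    Dw 𝕜 k n ((⇑(Δw 𝕜 k n j))^[q] f) = C (q * (N - q + 1)) * (⇑(Δw 𝕜 k n j))^[q - 1] f := by
  induction q with
  | zero => simpa using hD
  | succ q ih =>
    have h := congrArg (fun E => E ((⇑(Δw 𝕜 k n j))^[q] f)) (lie_Dw_Δw (𝕜 := 𝕜) (n := n) j)
    simp only [Derivation.commutator_apply] at h
    rw [weightDer_iterate_Δw hH, ih, derivation_map_C_mul, sub_eq_iff_eq_add] at h
    rw [Function.iterate_succ_apply', h, Nat.add_sub_cancel]
    rcases q with _ | q
    · simp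
    · rw [Nat.add_sub_cancel, ← Function.iterate_succ_apply' (⇑(Δw 𝕜 k n j)), ← add_mul, ← map_add]
      congr 2
      push_cast
      ring

/-- Semitransvectants of elements of `ker D` of weight `N` lie in `ker D`. -/
theorem Dw_semitransvectant {j₁ j₂ : Fin k}
    {f g : MvPolynomial (Σ j : Fin k, Fin (n j + 1)) 𝕜} {N : ℕ} (c : 𝕜)
    (hf : Dw 𝕜 k n f = 0) (hfH : weightDer j₁ f = C (N : 𝕜) * f)
    (hg : Dw 𝕜 k n g = 0) (hgH : weightDer j₂ g = C (N : 𝕜) * g) :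
    Dw 𝕜 k n (∑ q ∈ Finset.range (N + 1), C ((-1 : 𝕜) ^ q * c) *
      ((⇑(Δw 𝕜 k n j₁))^[N - q] f) * ((⇑(Δw 𝕜 k n j₂))^[q] g)) = 0 := by
  let G : ℕ → MvPolynomial (Σ j : Fin k, Fin (n j + 1)) 𝕜 := fun q =>
    C ((-1 : 𝕜) ^ q * c * (q * (N - q + 1))) *
      ((⇑(Δw 𝕜 k n j₁))^[N - q] f) * ((⇑(Δw 𝕜 k n j₂))^[q - 1] g)
  have key : ∀ q ∈ Finset.range (N + 1), Dw 𝕜 k n (C ((-1 : 𝕜) ^ q * c) *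
      ((⇑(Δw 𝕜 k n j₁))^[N - q] f) * ((⇑(Δw 𝕜 k n j₂))^[q] g)) = G q - G (q + 1) := by
    intro q hq
    rw [Finset.mem_range] at hq
    rw [mul_assoc, derivation_map_C_mul, Derivation.leibniz, Dw_iterate_Δw hf hfH,
      Dw_iterate_Δw hg hgH]
    have e1 : (C ((-1 : 𝕜) ^ (q + 1) * c * ((q + 1 : ℕ) * (N - (q + 1 : ℕ) + 1))) :
        MvPolynomial (Σ j : Fin k, Fin (n j + 1)) 𝕜)
        = - (C ((-1 : 𝕜) ^ q * c) * C ((N - q : ℕ) * ((N : 𝕜) - (N - q : ℕ) + 1))) := by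
      rw [← map_mul, ← map_neg]
      congr 1
      push_cast [Nat.cast_sub (show q ≤ N by omega)]
      ring
    simp only [G, e1, Nat.add_sub_cancel, smul_eq_mul, Nat.sub_sub]
    rw [map_mul C ((-1 : 𝕜) ^ q * c)]
    ring
  rw [map_sum, Finset.sum_congr rfl key, Finset.sum_range_sub']
  simp [G]

theorem Dw_wP {j₁ j₂ : Fin k} : Dw 𝕜 k n (wP 𝕜 k n j₁ j₂) = 0 := by
  have hD : ∀ (j : Fin k) (a : ℕ), Dw 𝕜 k n (Xv 𝕜 k n j 0 ^ a) = 0 := fun j a => by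
    rw [Derivation.leibniz_pow, Dw_Xv_zero, smul_zero, smul_zero]
  have hH : ∀ (j : Fin k) (a : ℕ), weightDer j (Xv 𝕜 k n j 0 ^ a)
      = C ((a * n j : ℕ) : 𝕜) * Xv 𝕜 k n j 0 ^ a := fun j a => by
    rw [Derivation.leibniz_pow, weightDer_Xv (Nat.zero_le _)]
    rcases a with _ | a
    · simp
    · simp only [Nat.add_sub_cancel, smul_eq_mul, nsmul_eq_mul, pow_succ, Nat.cast_zero, mul_zero,
        sub_zero, map_natCast]
      push_cast
      ring
  refine Dw_semitransvectant _ (hD _ _) ?_ (hD _ _) ?_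
  · rw [hH, Nat.div_mul_cancel (Nat.dvd_lcm_left _ _)]
  · rw [hH, Nat.div_mul_cancel (Nat.dvd_lcm_right _ _)]

theorem weightDer_fP {j : Fin k} {i : ℕ} (hi : i ≠ 0) (h : 2 * i ≤ n j) :
    weightDer j (fP 𝕜 k n j i) = C (2 * (n j : 𝕜) - 4 * i) * fP 𝕜 k n j i := by
  have hmul : ∀ p q : ℕ, p + q = 2 * i → ∀ c : 𝕜,
      weightDer j (C c * Xv 𝕜 k n j p * Xv 𝕜 k n j q)
        = C (2 * (n j : 𝕜) - 4 * i) * (C c * Xv 𝕜 k n j p * Xv 𝕜 k n j q) := by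
    intro p q hpq c
    have e : (C (2 * (n j : 𝕜) - 4 * i) : MvPolynomial (Σ j : Fin k, Fin (n j + 1)) 𝕜)
        = C ((n j : 𝕜) - 2 * p) + C ((n j : 𝕜) - 2 * q) := by
      have : (p : 𝕜) + q = 2 * i := by exact_mod_cast hpq
      rw [← map_add]; congr 1; linear_combination 2 * this
    rw [mul_assoc, derivation_map_C_mul, Derivation.leibniz, weightDer_Xv (by omega),
      weightDer_Xv (by omega), e]
    simp only [smul_eq_mul]
    ring
  rw [fP, if_neg hi, map_add, map_sum, mul_add, Finset.mul_sum]
  congr 1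
  · refine Finset.sum_congr rfl fun q hq => hmul _ _ ?_ _
    rw [Finset.mem_range] at hq
    omega
  · rw [sq, ← mul_assoc]
    exact hmul _ _ (by omega) _

theorem Dw_zP {j : Fin k} (h : n j % 4 = 0) : Dw 𝕜 k n (zP 𝕜 k n j) = 0 := by
  refine Dw_semitransvectant _ (Dw_Xv_zero j) ?_ (Dw_fP (by omega)) ?_
  · rw [weightDer_Xv (Nat.zero_le _)]
    simp
  · by_cases h0 : n j / 4 = 0
    · rw [h0, fP, if_pos rfl, weightDer_Xv (Nat.zero_le _)]
      simp
    · rw [weightDer_fP h0 (by omega)]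
      congr 2
      have : ((4 * (n j / 4) : ℕ) : 𝕜) = n j := by congr 1; omega
      push_cast at this
      linear_combination -this

theorem derivative_algHom_comp
    (E : Derivation 𝕜 (MvPolynomial (Σ j : Fin k, Fin (n j + 1)) 𝕜)
      (MvPolynomial (Σ j : Fin k, Fin (n j + 1)) 𝕜))
    (Θ : MvPolynomial (Σ j : Fin k, Fin (n j + 1)) 𝕜 →ₐ[𝕜] Polynomial 𝕜)
    (h : ∀ x, Polynomial.derivative (Θ (X x)) = Θ (E (X x)))
    (f : MvPolynomial (Σ j : Fin k, Fin (n j + 1)) 𝕜) :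
    Polynomial.derivative (Θ f) = Θ (E f) := by
  induction f using MvPolynomial.induction_on with
  | C a =>
    rw [← MvPolynomial.algebraMap_eq, AlgHom.commutes, Derivation.map_algebraMap, map_zero,
      Polynomial.algebraMap_apply, Polynomial.derivative_C]
  | add p q hp hq => simp only [map_add, hp, hq]
  | mul_X p x hp =>
    rw [map_mul, Polynomial.derivative_mul, hp, h, Derivation.leibniz, map_add, smul_eq_mul,
      smul_eq_mul, map_mul, map_mul]
    ring

theorem eval_aeval_polynomial (g : (Σ j : Fin k, Fin (n j + 1)) → Polynomial 𝕜) (s : 𝕜)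
    (f : MvPolynomial (Σ j : Fin k, Fin (n j + 1)) 𝕜) :
    (aeval g f).eval s = eval (fun x => (g x).eval s) f := by
  induction f using MvPolynomial.induction_on with
  | C a => simp
  | add p q hp hq => simp only [map_add, Polynomial.eval_add, hp, hq]
  | mul_X p x hp => simp only [map_mul, Polynomial.eval_mul, hp, aeval_X, eval_X]

/-- Iterates of a derivation are read off from the Taylor coefficients along an integral curve. -/
theorem eval_iterate_derivation
    (E : Derivation 𝕜 (MvPolynomial (Σ j : Fin k, Fin (n j + 1)) 𝕜)
      (MvPolynomial (Σ j : Fin k, Fin (n j + 1)) 𝕜))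
    (g : (Σ j : Fin k, Fin (n j + 1)) → Polynomial 𝕜)
    (h : ∀ x, Polynomial.derivative (g x) = aeval g (E (X x)))
    (v : (Σ j : Fin k, Fin (n j + 1)) → 𝕜) (hv : ∀ x, (g x).coeff 0 = v x) (r : ℕ)
    (f : MvPolynomial (Σ j : Fin k, Fin (n j + 1)) 𝕜) :
    eval v (E^[r] f) = r.factorial * (aeval g f).coeff r := by
  have h0 : ∀ p, eval v p = (aeval g p).coeff 0 := fun p => by
    rw [Polynomial.coeff_zero_eq_eval_zero, eval_aeval_polynomial]
    congr 2
    funext x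
    rw [← Polynomial.coeff_zero_eq_eval_zero, hv]
  have hc := derivative_algHom_comp E (aeval g) (fun x => by rw [aeval_X, h])
  have hr : aeval g (E^[r] f) = Polynomial.derivative^[r] (aeval g f) := by
    induction r with
    | zero => rfl
    | succ r ih => rw [Function.iterate_succ_apply', Function.iterate_succ_apply', ← ih, hc]
  rw [h0, hr, Polynomial.coeff_iterate_derivative, zero_add, Nat.descFactorial_self, nsmul_eq_mul]

/-- The action of `exp (s D)` on the coordinates of a single block. -/
noncomputable def shift (s : 𝕜) (b : ℕ → 𝕜) (i : ℕ) : 𝕜 :=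
  ∑ q ∈ Finset.range (i + 1), s ^ q / (q.factorial : 𝕜) * b (i - q)

/-- The coordinates of a point in block `j`, extended by zero. -/
noncomputable def coord (v : (Σ j : Fin k, Fin (n j + 1)) → 𝕜) (j : Fin k) (i : ℕ) : 𝕜 :=
  eval v (Xv 𝕜 k n j i)

theorem coord_fin (v : (Σ j : Fin k, Fin (n j + 1)) → 𝕜) (x : Σ j : Fin k, Fin (n j + 1)) :
    coord v x.1 x.2 = v x := by
  rw [coord, Xv_fin, eval_X]

theorem coord_of_le (v : (Σ j : Fin k, Fin (n j + 1)) → 𝕜) {j : Fin k} {i : ℕ} (h : i ≤ n j) :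
    coord v j i = v ⟨j, ⟨i, Nat.lt_succ_of_le h⟩⟩ := by
  rw [coord, Xv_of_le h, eval_X]

/-- Elements of `ker D` are invariant under `exp (s D)`. -/
theorem eval_shift {f : MvPolynomial (Σ j : Fin k, Fin (n j + 1)) 𝕜} (hf : Dw 𝕜 k n f = 0) (s : 𝕜)
    (v : (Σ j : Fin k, Fin (n j + 1)) → 𝕜) :
    eval (fun x => shift s (coord v x.1) x.2) f = eval v f := by
  let G : Fin k → ℕ → Polynomial 𝕜 := fun j i => ∑ q ∈ Finset.range (i + 1),
    Polynomial.C (coord v j (i - q) / (q.factorial : 𝕜)) * Polynomial.X ^ q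
  let g : (Σ j : Fin k, Fin (n j + 1)) → Polynomial 𝕜 := fun x => G x.1 x.2
  have hg : ∀ s, eval (fun x => (g x).eval s) f = (aeval g f).eval s :=
    fun s => (eval_aeval_polynomial g s f).symm
  have hd : Polynomial.derivative (aeval g f) = 0 := by
    rw [derivative_algHom_comp (Dw 𝕜 k n) (aeval g) ?_, hf, map_zero]
    rintro ⟨j, i, hi⟩
    have hi : i ≤ n j := Nat.le_of_lt_succ hi
    rw [aeval_X, ← Xv_fin]
    simp only [g]
    rcases i with _ | i
    · rw [Dw_Xv_zero, map_zero]
      simp [G]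
    · rw [Dw_Xv_succ hi, Xv_of_le (by omega), aeval_X]
      simp only [G]
      rw [Finset.sum_range_succ', Polynomial.derivative_add, Polynomial.derivative_sum, pow_zero,
        mul_one, Polynomial.derivative_C, add_zero]
      refine Finset.sum_congr rfl fun q _ => ?_
      rw [Polynomial.derivative_C_mul_X_pow, Nat.add_sub_cancel, Nat.add_sub_add_right]
      congr 2
      have h2 : ((q : 𝕜) + 1) ≠ 0 := by exact_mod_cast q.succ_ne_zero
      rw [Nat.factorial_succ]
      push_cast
      field_simp
  have hc := Polynomial.eq_C_of_derivative_eq_zero hd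
  have h1 : (fun x => (g x).eval s) = fun x => shift s (coord v x.1) x.2 := by
    funext x
    simp only [g, G, shift, Polynomial.eval_finsetSum]
    refine Finset.sum_congr rfl fun q _ => ?_
    rw [Polynomial.eval_C_mul, Polynomial.eval_X_pow]
    ring
  have h2 : (fun x => (g x).eval 0) = v := by
    funext x
    simp only [g, G, Polynomial.eval_finsetSum]
    rw [Finset.sum_range_succ', Finset.sum_eq_zero (fun q _ => by simp)]
    simp [coord_fin]
  rw [← h1, hg]
  conv_rhs => rw [← h2]
  rw [hg, hc, Polynomial.eval_C, Polynomial.eval_C]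

theorem shift_congr {s : 𝕜} {b c : ℕ → 𝕜} {i : ℕ} (h : ∀ q ≤ i, b q = c q) :
    shift s b i = shift s c i :=
  Finset.sum_congr rfl fun q _ => by rw [h _ (Nat.sub_le _ _)]

/-- In terms of the polynomial `∑ b_i X^{N-i} / (N-i)!`, the shift is translation. -/
theorem shift_factorial_mul_coeff (F : Polynomial 𝕜) {N i : ℕ} (hi : i ≤ N) (hF : F.natDegree ≤ N)
    (s : 𝕜) :
    shift s (fun i => ((N - i).factorial : 𝕜) * F.coeff (N - i)) i
      = ((N - i).factorial : 𝕜) * (Polynomial.taylor s F).coeff (N - i) := by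
  have hdeg : (Polynomial.hasseDeriv (N - i) F).natDegree < i + 1 := by
    have := Polynomial.natDegree_hasseDeriv_le F (N - i)
    omega
  rw [Polynomial.taylor_coeff, Polynomial.eval_eq_sum_range' hdeg, Finset.mul_sum, shift]
  refine Finset.sum_congr rfl fun q hq => ?_
  rw [Finset.mem_range] at hq
  rw [Polynomial.hasseDeriv_coeff, show N - (i - q) = q + (N - i) by omega]
  have h := congrArg (Nat.cast : ℕ → 𝕜) (Nat.add_choose_mul_factorial_mul_factorial q (N - i))
  push_cast at h
  have h1 : (q.factorial : 𝕜) ≠ 0 := by exact_mod_cast q.factorial_ne_zero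
  rw [← h]
  field_simp

/-- The integral curve of `Δ_j` through a point, in the coordinates of block `j`. -/
noncomputable def raise (N : ℕ) (a : ℕ → 𝕜) (i : ℕ) : Polynomial 𝕜 :=
  ∑ p ∈ Finset.range (N + 1),
    Polynomial.C (a p * (p.choose i : 𝕜) * ((N - i).factorial : 𝕜) / ((N - p).factorial : 𝕜))
      * Polynomial.X ^ (p - i)

theorem derivative_raise {N i : ℕ} (hi : i ≤ N) (a : ℕ → 𝕜) :
    Polynomial.derivative (raise N a i)
      = Polynomial.C (((N - i) * (i + 1) : ℕ) : 𝕜) * raise N a (i + 1) := by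
  rw [raise, raise, Polynomial.derivative_sum, Finset.mul_sum]
  refine Finset.sum_congr rfl fun p hp => ?_
  rw [Finset.mem_range] at hp
  rw [Polynomial.derivative_C_mul_X_pow, ← mul_assoc, ← map_mul, Nat.sub_sub]
  congr 2
  rcases le_or_gt p i with h | h
  · rw [Nat.sub_eq_zero_of_le h, Nat.choose_eq_zero_of_lt (show p < i + 1 by omega)]
    simp
  · have e1 := congrArg (Nat.cast : ℕ → 𝕜) (Nat.choose_succ_right_eq p i)
    have e2 : N - i = N - (i + 1) + 1 := by omega
    rw [e2, Nat.factorial_succ]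
    push_cast at e1 ⊢
    linear_combination -(((N - (i + 1) : ℕ) : 𝕜) + 1) * a p * ((N - (i + 1)).factorial : 𝕜)
      / ((N - p).factorial : 𝕜) * e1

/-- Factor out the lowest power of the curve through a point with vanishing low coordinates. -/
theorem exists_raise_eq_X_pow_mul {N m : ℕ} (hm : m ≤ N) {a : ℕ → 𝕜} (ha : ∀ p < m, a p = 0)
    {i : ℕ} (hi : i ≤ m) :
    ∃ g : Polynomial 𝕜, raise N a i = Polynomial.X ^ (m - i) * g ∧
      g.coeff 0 = a m * (m.choose i : 𝕜) * ((N - i).factorial : 𝕜) / ((N - m).factorial : 𝕜) := by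
  refine ⟨∑ p ∈ Finset.range (N + 1), Polynomial.C (a p * (p.choose i : 𝕜) *
    ((N - i).factorial : 𝕜) / ((N - p).factorial : 𝕜)) * Polynomial.X ^ (p - m), ?_, ?_⟩
  · rw [raise, Finset.mul_sum]
    refine Finset.sum_congr rfl fun p _ => ?_
    rcases lt_or_ge p m with h | h
    · simp [ha p h]
    · rw [show p - i = (m - i) + (p - m) by omega, pow_add]
      ring
  · rw [Polynomial.finsetSum_coeff, Finset.sum_eq_single m]
    · simp
    · intro p _ hp
      rcases lt_or_gt_of_ne hp with h | h
      · simp [ha p h]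
      · rw [Polynomial.coeff_C_mul_X_pow, if_neg (by omega)]
    · intro h
      exact absurd (Finset.mem_range.2 (by omega)) h

theorem coeff_zero_raise {N i : ℕ} (hi : i ≤ N) (a : ℕ → 𝕜) : (raise N a i).coeff 0 = a i := by
  rw [raise, Polynomial.finsetSum_coeff, Finset.sum_eq_single i]
  · have h1 : ((N - i).factorial : 𝕜) ≠ 0 := by exact_mod_cast (N - i).factorial_ne_zero
    simp [h1]
  · intro p _ hp
    rcases lt_or_gt_of_ne hp with h | h
    · simp [Nat.choose_eq_zero_of_lt h]
    · rw [Polynomial.coeff_C_mul_X_pow, if_neg (by omega)]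
  · intro h
    exact absurd (Finset.mem_range.2 (by omega)) h

/-- The integral curve of `Δ_j` through `v`. -/
noncomputable def raiseCurve (v : (Σ j : Fin k, Fin (n j + 1)) → 𝕜) (j : Fin k)
    (x : Σ j : Fin k, Fin (n j + 1)) : Polynomial 𝕜 :=
  if x.1 = j then raise (n x.1) (coord v x.1) x.2 else Polynomial.C (v x)

theorem aeval_raiseCurve_Xv (v : (Σ j : Fin k, Fin (n j + 1)) → 𝕜) {j : Fin k} {i : ℕ}
    (hi : i ≤ n j) :
    aeval (raiseCurve v j) (Xv 𝕜 k n j i) = raise (n j) (coord v j) i := by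
  rw [Xv_of_le hi, aeval_X, raiseCurve, if_pos rfl]

theorem eval_iterate_Δw (v : (Σ j : Fin k, Fin (n j + 1)) → 𝕜) (j : Fin k) (r : ℕ)
    (f : MvPolynomial (Σ j : Fin k, Fin (n j + 1)) 𝕜) :
    eval v ((⇑(Δw 𝕜 k n j))^[r] f) = r.factorial * (aeval (raiseCurve v j) f).coeff r := by
  refine eval_iterate_derivation _ _ (fun x => ?_) v (fun x => ?_) r f
  · by_cases hj : x.1 = j
    · obtain ⟨j', i, hi⟩ := x
      have hi : i ≤ n j' := Nat.le_of_lt_succ hi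
      simp only at hj
      subst hj
      rw [← Xv_fin, Δw_Xv hi, raiseCurve, if_pos rfl, derivative_raise hi, map_mul,
        ← MvPolynomial.algebraMap_eq, AlgHom.commutes, Polynomial.algebraMap_apply,
        Algebra.algebraMap_self, RingHom.id_apply]
      rcases hi.lt_or_eq with h | h
      · rw [aeval_raiseCurve_Xv v h]
      · simp [← h]
    · rw [← Xv_fin, Δw_Xv_of_ne hj, raiseCurve, if_neg hj, Polynomial.derivative_C, map_zero]
  · rw [raiseCurve]
    split_ifs with hj
    · rw [coeff_zero_raise (Nat.le_of_lt_succ x.2.2), coord_fin]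
    · rw [Polynomial.coeff_C_zero]

/-- The value of `f_{i,j}`, `i ≥ 1`, in terms of the coordinates in block `j`. -/
noncomputable def quad (b : ℕ → 𝕜) (i : ℕ) : 𝕜 :=
  (∑ q ∈ Finset.range i, (-1) ^ q * b q * b (2 * i - q)) + (-1) ^ i / 2 * b i ^ 2

theorem quad_congr {b c : ℕ → 𝕜} {i : ℕ} (h : ∀ q ≤ 2 * i, b q = c q) : quad b i = quad c i := by
  rw [quad, quad, h i (by omega)]
  congr 1
  refine Finset.sum_congr rfl fun q hq => ?_
  rw [Finset.mem_range] at hq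
  rw [h q (by omega), h _ (Nat.sub_le _ _)]

theorem eval_fP_zero (v : (Σ j : Fin k, Fin (n j + 1)) → 𝕜) (j : Fin k) :
    eval v (fP 𝕜 k n j 0) = coord v j 0 := by
  rw [fP, if_pos rfl, coord]

theorem eval_fP (v : (Σ j : Fin k, Fin (n j + 1)) → 𝕜) (j : Fin k) {i : ℕ} (hi : i ≠ 0) :
    eval v (fP 𝕜 k n j i) = quad (coord v j) i := by
  simp only [fP, if_neg hi, quad, coord, map_add, map_sum, map_mul, map_pow, eval_C]

theorem quad_shift (s : 𝕜) (b : ℕ → 𝕜) {i : ℕ} (hi : i ≠ 0) : quad (shift s b) i = quad b i := by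
  let n' : Fin 1 → ℕ := fun _ => 2 * i
  let v : (Σ j : Fin 1, Fin (n' j + 1)) → 𝕜 := fun x => b x.2
  have hv : ∀ q ≤ 2 * i, coord v 0 q = b q := fun q hq => coord_of_le v (j := 0) hq
  have h := eval_shift (Dw_fP (𝕜 := 𝕜) (n := n') (j := 0) (le_refl (2 * i))) s v
  rw [eval_fP _ _ hi, eval_fP _ _ hi, quad_congr hv] at h
  rw [← h]
  refine quad_congr fun q hq => ?_
  rw [coord_of_le _ (show q ≤ n' 0 from hq)]
  exact shift_congr fun p hp => (hv p (hp.trans hq)).symm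

/-- The translate `(X² - 1/4)^{2h}` of the form `X^{2h} (X + 1)^{2h}` in coordinates. -/
theorem exists_shift_factorial_mul_choose (h : ℕ) : ∃ c : ℕ → ℚ, (∀ i ≤ 2 * h, 0 < c i) ∧
    (∀ r, 2 * r ≤ 2 * h → shift (-(1 / 2) : ℚ) (fun i => ((4 * h - i).factorial : ℚ) *
      ((2 * h).choose i : ℚ)) (2 * r) = (-(1 / 4)) ^ r * c (2 * r)) ∧
    (∀ r, 2 * r + 1 ≤ 2 * h → shift (-(1 / 2) : ℚ) (fun i => ((4 * h - i).factorial : ℚ) *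
      ((2 * h).choose i : ℚ)) (2 * r + 1) = 0) := by
  let F : Polynomial ℚ := (Polynomial.X + Polynomial.C 1) ^ (2 * h) * Polynomial.X ^ (2 * h)
  have hF : F.natDegree ≤ 4 * h := by
    refine Polynomial.natDegree_mul_le.trans ?_
    rw [Polynomial.natDegree_X_pow, Polynomial.natDegree_pow, Polynomial.natDegree_X_add_C]
    omega
  have hcoeff : ∀ i ≤ 2 * h, F.coeff (4 * h - i) = ((2 * h).choose i : ℚ) := by
    intro i hi
    rw [Polynomial.coeff_mul_X_pow', if_pos (by omega), Polynomial.coeff_X_add_C_pow, one_pow,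
      one_mul, show 4 * h - i - 2 * h = 2 * h - i by omega, Nat.choose_symm hi]
  have hT : Polynomial.taylor (-(1 / 2) : ℚ) F
      = Polynomial.expand ℚ 2 ((Polynomial.X + Polynomial.C (-(1 / 4))) ^ (2 * h)) := by
    rw [Polynomial.taylor_mul, Polynomial.taylor_pow, Polynomial.taylor_pow, map_add,
      Polynomial.taylor_X, Polynomial.taylor_C, map_pow, map_add, Polynomial.expand_X,
      Polynomial.expand_C, ← mul_pow]
    congr 1
    have e1 : (Polynomial.C (-(1 / 2)) : Polynomial ℚ) + Polynomial.C 1 = Polynomial.C (1 / 2) := by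
      rw [← map_add]; norm_num
    have e2 : (Polynomial.C (-(1 / 4)) : Polynomial ℚ)
        = Polynomial.C (-(1 / 2)) * Polynomial.C (1 / 2) := by
      rw [← map_mul]; norm_num
    have e3 : (Polynomial.C (-(1 / 2)) : Polynomial ℚ) = - Polynomial.C (1 / 2) := by
      rw [← map_neg]
    rw [add_assoc, e1, e2, e3]
    ring
  have hs : ∀ i ≤ 2 * h, shift (-(1 / 2) : ℚ) (fun i => ((4 * h - i).factorial : ℚ) *
      ((2 * h).choose i : ℚ)) i = ((4 * h - i).factorial : ℚ) *
      (if 2 ∣ 4 * h - i then ((Polynomial.X + Polynomial.C (-(1 / 4) : ℚ)) ^ (2 * h)).coeff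
        ((4 * h - i) / 2) else 0) := by
    intro i hi
    rw [← Polynomial.coeff_expand two_pos, ← hT, ← shift_factorial_mul_coeff F (by omega) hF]
    exact shift_congr fun q hq => by rw [hcoeff q (by omega)]
  refine ⟨fun i => ((4 * h - i).factorial : ℚ) * ((2 * h).choose (2 * h - i / 2) : ℚ),
    fun i hi => ?_, fun r hr => ?_, fun r hr => ?_⟩
  · have := Nat.choose_pos (show 2 * h - i / 2 ≤ 2 * h by omega)
    have := Nat.factorial_pos (4 * h - i)
    positivity
  · rw [hs _ hr, if_pos (by omega), Polynomial.coeff_X_add_C_pow,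
      show (4 * h - 2 * r) / 2 = 2 * h - r by omega, show 2 * h - (2 * h - r) = r by omega,
      mul_left_comm]
    simp only [Nat.mul_div_cancel_left r two_pos]
  · rw [hs _ hr, if_neg (by omega), mul_zero]

theorem quad_factorial_mul_choose_ne_zero_rat {h : ℕ} (hh : h ≠ 0) :
    quad (fun i => ((4 * h - i).factorial : ℚ) * ((2 * h).choose i : ℚ)) h ≠ 0 := by
  rw [← quad_shift (-(1 / 2)) _ hh]
  obtain ⟨c, hc, he, ho⟩ := exists_shift_factorial_mul_choose h
  generalize shift (-(1 / 2) : ℚ) (fun i => ((4 * h - i).factorial : ℚ) *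
    ((2 * h).choose i : ℚ)) = b at he ho
  have hterm : ∀ r, 2 * r ≤ h → (-4) ^ h * ((-1) ^ (2 * r) * b (2 * r) * b (2 * h - 2 * r))
      = c (2 * r) * c (2 * (h - r)) := by
    intro r hr
    rw [show 2 * h - 2 * r = 2 * (h - r) by omega, he r (by omega), he (h - r) (by omega)]
    have e : ((-4 : ℚ)) ^ h * ((-(1 / 4)) ^ r * (-(1 / 4)) ^ (h - r)) = 1 := by
      rw [← pow_add, show r + (h - r) = h by omega, ← mul_pow]
      norm_num
    rw [pow_mul, neg_one_sq, one_pow]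
    linear_combination c (2 * r) * c (2 * (h - r)) * e
  have hnonneg : ∀ q ≤ h, 0 ≤ (-4) ^ h * ((-1) ^ q * b q * b (2 * h - q)) := by
    intro q hq
    rcases Nat.even_or_odd' q with ⟨r, rfl | rfl⟩
    · rw [hterm r hq]
      exact (mul_pos (hc _ (by omega)) (hc _ (by omega))).le
    · rw [ho r (by omega)]
      simp
  have hpos : 0 < (-4) ^ h * quad b h := by
    rw [quad, mul_add, Finset.mul_sum]
    refine add_pos_of_pos_of_nonneg (Finset.sum_pos' (fun q hq => hnonneg q
      (Finset.mem_range.1 hq).le) ⟨0, Finset.mem_range.2 (Nat.pos_of_ne_zero hh), ?_⟩) ?_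
    · have := hterm 0 (by omega)
      rw [mul_zero] at this
      rw [this]
      exact mul_pos (hc _ (by omega)) (hc _ (by omega))
    · have := hnonneg h le_rfl
      rw [show 2 * h - h = h by omega] at this
      linarith
  intro h0
  rw [h0, mul_zero] at hpos
  exact lt_irrefl _ hpos

theorem quad_factorial_mul_choose_ne_zero {h : ℕ} (hh : h ≠ 0) :
    quad (fun i => ((4 * h - i).factorial : 𝕜) * ((2 * h).choose i : 𝕜)) h ≠ 0 := by
  have e : quad (fun i => ((4 * h - i).factorial : 𝕜) * ((2 * h).choose i : 𝕜)) h
      = ((quad (fun i => ((4 * h - i).factorial : ℚ) * ((2 * h).choose i : ℚ)) h : ℚ) : 𝕜) := by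
    simp only [quad]
    push_cast
    rfl
  rw [e]
  exact_mod_cast quad_factorial_mul_choose_ne_zero_rat hh

theorem coeff_X_pow_mul_of_lt (g : Polynomial 𝕜) {d r : ℕ} (h : r < d) :
    (Polynomial.X ^ d * g).coeff r = 0 := by
  rw [Polynomial.coeff_X_pow_mul', if_neg (by omega)]

theorem coeff_X_pow_mul_self (g : Polynomial 𝕜) (d : ℕ) :
    (Polynomial.X ^ d * g).coeff d = g.coeff 0 := by
  rw [Polynomial.coeff_X_pow_mul', if_pos le_rfl, Nat.sub_self]

theorem exists_aeval_raiseCurve_Xv_zero_pow {v : (Σ j : Fin k, Fin (n j + 1)) → 𝕜} {j : Fin k}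
    {m : ℕ} (hm : n j = 2 * m) (hv : ∀ p < m, coord v j p = 0) (A : ℕ) :
    ∃ g : Polynomial 𝕜, aeval (raiseCurve v j) (Xv 𝕜 k n j 0 ^ A) = Polynomial.X ^ (m * A) * g ∧
      g.coeff 0 = (((2 * m).factorial : 𝕜) / (m.factorial : 𝕜)) ^ A * coord v j m ^ A := by
  obtain ⟨g, hg, hg0⟩ := exists_raise_eq_X_pow_mul (N := n j) (by omega) hv (Nat.zero_le m)
  refine ⟨g ^ A, ?_, ?_⟩
  · rw [map_pow, aeval_raiseCurve_Xv v (Nat.zero_le _), hg, mul_pow, ← pow_mul, Nat.sub_zero]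
  · rw [Polynomial.coeff_zero_eq_eval_zero, Polynomial.eval_pow,
      ← Polynomial.coeff_zero_eq_eval_zero, hg0, hm, ← mul_pow, Nat.sub_zero,
      show 2 * m - m = m by omega, Nat.choose_zero_right]
    congr 1
    push_cast
    ring

theorem exists_aeval_raiseCurve_fP {v : (Σ j : Fin k, Fin (n j + 1)) → 𝕜} {j : Fin k}
    {h : ℕ} (hh : h ≠ 0) (hn : n j = 4 * h) (hv : ∀ p < 2 * h, coord v j p = 0) :
    ∃ g : Polynomial 𝕜, aeval (raiseCurve v j) (fP 𝕜 k n j h) = Polynomial.X ^ (2 * h) * g ∧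
      g.coeff 0 = quad (fun i => ((4 * h - i).factorial : 𝕜) * ((2 * h).choose i : 𝕜)) h
        * (((2 * h).factorial : 𝕜)⁻¹ * coord v j (2 * h)) ^ 2 := by
  have hex : ∀ i, ∃ g : Polynomial 𝕜, i ≤ 2 * h →
      aeval (raiseCurve v j) (Xv 𝕜 k n j i) = Polynomial.X ^ (2 * h - i) * g ∧
      g.coeff 0 = (((2 * h).factorial : 𝕜)⁻¹ * coord v j (2 * h)) *
        (((4 * h - i).factorial : 𝕜) * ((2 * h).choose i : 𝕜)) := by
    intro i
    by_cases hi : i ≤ 2 * h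
    · obtain ⟨g, hg, hg0⟩ := exists_raise_eq_X_pow_mul (N := n j) (by omega) hv hi
      refine ⟨g, fun _ => ⟨by rw [aeval_raiseCurve_Xv v (by omega), hg], ?_⟩⟩
      rw [hg0, hn, show 4 * h - 2 * h = 2 * h by omega]
      ring
    · exact ⟨0, fun h => absurd h hi⟩
  choose g hg using hex
  refine ⟨(∑ q ∈ Finset.range h, Polynomial.C ((-1 : 𝕜) ^ q) * g q * g (2 * h - q))
    + Polynomial.C ((-1 : 𝕜) ^ h / 2) * g h ^ 2, ?_, ?_⟩
  · simp only [fP, if_neg hh, map_add, map_sum, map_mul, map_pow (aeval (raiseCurve v j)),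
      aeval_C, Polynomial.algebraMap_eq]
    rw [mul_add, Finset.mul_sum]
    congr 1
    · refine Finset.sum_congr rfl fun q hq => ?_
      rw [Finset.mem_range] at hq
      rw [(hg q (by omega)).1, (hg (2 * h - q) (by omega)).1]
      have e : (Polynomial.X : Polynomial 𝕜) ^ (2 * h)
          = Polynomial.X ^ (2 * h - q) * Polynomial.X ^ (2 * h - (2 * h - q)) := by
        rw [← pow_add]; congr 1; omega
      rw [e]
      ring
    · rw [(hg h (by omega)).1, mul_pow, ← pow_mul, show (2 * h - h) * 2 = 2 * h by omega]
      ring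
  · rw [Polynomial.coeff_zero_eq_eval_zero, Polynomial.eval_add, Polynomial.eval_finsetSum, quad,
      add_mul, Finset.sum_mul]
    simp only [Polynomial.eval_mul, Polynomial.eval_C, Polynomial.eval_pow,
      ← Polynomial.coeff_zero_eq_eval_zero]
    congr 1
    · refine Finset.sum_congr rfl fun q hq => ?_
      rw [Finset.mem_range] at hq
      rw [(hg q (by omega)).2, (hg (2 * h - q) (by omega)).2]
      ring
    · rw [(hg h (by omega)).2]
      ring

theorem exists_eval_zP {j : Fin k} (h4 : n j % 4 = 0) (h0 : n j ≠ 0) :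
    ∃ κ : 𝕜, κ ≠ 0 ∧ ∀ v : (Σ j : Fin k, Fin (n j + 1)) → 𝕜,
      (∀ p, 2 * p < n j → coord v j p = 0) →
      eval v (zP 𝕜 k n j) = κ * coord v j (n j / 2) ^ 3 := by
  obtain ⟨h, hn⟩ : ∃ h, n j = 4 * h := ⟨n j / 4, by omega⟩
  have hh : h ≠ 0 := by omega
  have hm : n j = 2 * (2 * h) := by omega
  have hf : ∀ r : ℕ, (r.factorial : 𝕜) ≠ 0 := fun r => by exact_mod_cast r.factorial_ne_zero
  refine ⟨((n j).factorial : 𝕜) * ((2 * h).factorial * (((2 * (2 * h)).factorial : 𝕜) /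
    ((2 * h).factorial : 𝕜))) * ((2 * h).factorial *
      (quad (fun i => ((4 * h - i).factorial : 𝕜) * ((2 * h).choose i : 𝕜)) h
        * ((2 * h).factorial : 𝕜)⁻¹ ^ 2)), ?_, fun v hv => ?_⟩
  · have := quad_factorial_mul_choose_ne_zero (𝕜 := 𝕜) hh
    simp [hf, this]
  have hv' : ∀ p < 2 * h, coord v j p = 0 := fun p hp => hv p (by omega)
  obtain ⟨g₁, hg₁, hg₁0⟩ := exists_aeval_raiseCurve_Xv_zero_pow hm hv' 1
  obtain ⟨g₂, hg₂, hg₂0⟩ := exists_aeval_raiseCurve_fP hh hn hv'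
  rw [pow_one, mul_one] at hg₁
  rw [pow_one, pow_one] at hg₁0
  rw [zP, map_sum, show n j / 4 = h by omega, show n j / 2 = 2 * h by omega,
    Finset.sum_eq_single (2 * h)]
  · rw [map_mul, map_mul, eval_C, eval_iterate_Δw, eval_iterate_Δw, hg₁, hg₂,
      show n j - 2 * h = 2 * h by omega, coeff_X_pow_mul_self, coeff_X_pow_mul_self, hg₁0, hg₂0,
      pow_mul, neg_one_sq, one_pow]
    ring
  · intro q hq hne
    rw [Finset.mem_range] at hq
    rw [map_mul, map_mul, eval_iterate_Δw, eval_iterate_Δw, hg₁, hg₂]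
    rcases lt_or_gt_of_ne hne with hlt | hgt
    · rw [coeff_X_pow_mul_of_lt g₂ hlt, mul_zero, mul_zero]
    · rw [coeff_X_pow_mul_of_lt g₁ (by omega), mul_zero, mul_zero, zero_mul]
  · intro hq
    exact absurd (Finset.mem_range.2 (by omega)) hq

theorem exists_eval_wP {j₁ j₂ : Fin k} (h₁ : n j₁ % 4 = 2) (h₂ : n j₂ % 4 = 2) :
    ∃ κ : 𝕜, κ ≠ 0 ∧ ∀ v : (Σ j : Fin k, Fin (n j + 1)) → 𝕜,
      (∀ j p, 2 * p < n j → coord v j p = 0) →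
      eval v (wP 𝕜 k n j₁ j₂) = κ * (coord v j₁ (n j₁ / 2) ^ (Nat.lcm (n j₁) (n j₂) / n j₁) *
        coord v j₂ (n j₂ / 2) ^ (Nat.lcm (n j₁) (n j₂) / n j₂)) := by
  obtain ⟨m₁, hm₁⟩ : ∃ m, n j₁ = 2 * m := ⟨n j₁ / 2, by omega⟩
  obtain ⟨m₂, hm₂⟩ : ∃ m, n j₂ = 2 * m := ⟨n j₂ / 2, by omega⟩
  have hN₁ : n j₁ * (Nat.lcm (n j₁) (n j₂) / n j₁) = Nat.lcm (n j₁) (n j₂) :=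
    Nat.mul_div_cancel' (Nat.dvd_lcm_left _ _)
  have hN₂ : n j₂ * (Nat.lcm (n j₁) (n j₂) / n j₂) = Nat.lcm (n j₁) (n j₂) :=
    Nat.mul_div_cancel' (Nat.dvd_lcm_right _ _)
  unfold wP
  generalize Nat.lcm (n j₁) (n j₂) / n j₁ = A₁ at *
  generalize Nat.lcm (n j₁) (n j₂) / n j₂ = A₂ at *
  generalize Nat.lcm (n j₁) (n j₂) = N at *
  have hN₁' : N = 2 * (m₁ * A₁) := by rw [← hN₁, hm₁, mul_assoc]
  have hN₂' : m₂ * A₂ = m₁ * A₁ := by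
    have : 2 * (m₂ * A₂) = 2 * (m₁ * A₁) := by rw [← hN₁', ← hN₂, hm₂, mul_assoc]
    omega
  have hf : ∀ r : ℕ, (r.factorial : 𝕜) ≠ 0 := fun r => by exact_mod_cast r.factorial_ne_zero
  refine ⟨(-1) ^ (m₁ * A₁) * (N.factorial : 𝕜) *
    ((m₁ * A₁).factorial * (((2 * m₁).factorial : 𝕜) / (m₁.factorial : 𝕜)) ^ A₁) *
    ((m₁ * A₁).factorial * (((2 * m₂).factorial : 𝕜) / (m₂.factorial : 𝕜)) ^ A₂), ?_,
    fun v hv => ?_⟩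
  · simp [hf]
  obtain ⟨g₁, hg₁, hg₁0⟩ :=
    exists_aeval_raiseCurve_Xv_zero_pow hm₁ (fun p hp => hv j₁ p (by omega)) A₁
  obtain ⟨g₂, hg₂, hg₂0⟩ :=
    exists_aeval_raiseCurve_Xv_zero_pow hm₂ (fun p hp => hv j₂ p (by omega)) A₂
  rw [hN₂'] at hg₂
  rw [map_sum, show n j₁ / 2 = m₁ by omega, show n j₂ / 2 = m₂ by omega,
    Finset.sum_eq_single (m₁ * A₁)]
  · rw [map_mul, map_mul, eval_C, eval_iterate_Δw, eval_iterate_Δw, hg₁, hg₂,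
      show N - m₁ * A₁ = m₁ * A₁ by omega, coeff_X_pow_mul_self, coeff_X_pow_mul_self, hg₁0, hg₂0]
    ring
  · intro q hq hne
    rw [Finset.mem_range] at hq
    rw [map_mul, map_mul, eval_iterate_Δw, eval_iterate_Δw, hg₁, hg₂]
    rcases lt_or_gt_of_ne hne with hlt | hgt
    · rw [coeff_X_pow_mul_of_lt g₂ hlt, mul_zero, mul_zero]
    · rw [coeff_X_pow_mul_of_lt g₁ (by omega), mul_zero, mul_zero, zero_mul]
  · intro hq
    exact absurd (Finset.mem_range.2 (by omega)) hq

theorem odd_lcm_div_left {a b : ℕ} (ha : a % 4 = 2) (hb : b % 4 = 2) :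
    Odd (Nat.lcm a b / a) := by
  rw [← Nat.not_even_iff_odd]
  rintro ⟨c, hc⟩
  have h1 : a * (Nat.lcm a b / a) = Nat.lcm a b := Nat.mul_div_cancel' (Nat.dvd_lcm_left _ _)
  have h2 := Nat.gcd_mul_lcm a b
  rw [← h1, mul_left_comm] at h2
  have h3 := Nat.eq_of_mul_eq_mul_left (by omega) h2
  obtain ⟨d, hd⟩ : 2 ∣ Nat.gcd a b := Nat.dvd_gcd (by omega) (by omega)
  rw [hc, hd] at h3
  have : b = 4 * (d * c) := by rw [← h3]; ring
  omega

/-- The endpoint curve of the degeneration used in `eval_eq_eval_middle`. -/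
noncomputable def lower (N : ℕ) (a : ℕ → 𝕜) (i : ℕ) : Polynomial 𝕜 :=
  ∑ p ∈ Finset.range (N + 1),
    Polynomial.C (a p * (-1) ^ i * ((N - p).choose i : 𝕜) * ((N - i).factorial : 𝕜)
      / ((N - p).factorial : 𝕜)) * Polynomial.X ^ (p - i)

theorem shift_eval_raise {N i : ℕ} (hi : i ≤ N) {a : ℕ → 𝕜} (ha : ∀ p, 2 * p < N → a p = 0)
    {τ : 𝕜} (hτ : τ ≠ 0) :
    shift (-τ⁻¹) (fun i => (raise N a i).eval τ) i = (lower N a i).eval τ := by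
  let F : Polynomial 𝕜 := ∑ p ∈ Finset.range (N + 1),
    Polynomial.C (a p / ((N - p).factorial : 𝕜) * τ ^ p) *
      ((Polynomial.X + Polynomial.C τ⁻¹) ^ p * Polynomial.X ^ (N - p))
  have hdeg : F.natDegree ≤ N := by
    refine Polynomial.natDegree_sum_le_of_forall_le _ _ fun p hp => ?_
    rw [Finset.mem_range] at hp
    refine (Polynomial.natDegree_C_mul_le _ _).trans (Polynomial.natDegree_mul_le.trans ?_)
    rw [Polynomial.natDegree_X_pow, Polynomial.natDegree_pow, Polynomial.natDegree_X_add_C]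
    omega
  have hraise : ∀ i ≤ N, (raise N a i).eval τ = ((N - i).factorial : 𝕜) * F.coeff (N - i) := by
    intro i hi
    simp only [raise, F, Polynomial.eval_finsetSum, Polynomial.finsetSum_coeff, Finset.mul_sum]
    refine Finset.sum_congr rfl fun p hp => ?_
    rw [Finset.mem_range] at hp
    rw [Polynomial.eval_C_mul, Polynomial.eval_X_pow, Polynomial.coeff_C_mul,
      Polynomial.coeff_mul_X_pow']
    split_ifs with h
    · have hip : i ≤ p := by omega
      rw [Polynomial.coeff_X_add_C_pow, show N - i - (N - p) = p - i by omega,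
        Nat.choose_symm hip, Nat.sub_sub_self hip]
      have e : τ ^ p * τ⁻¹ ^ i = τ ^ (p - i) := by
        rw [inv_pow, pow_sub₀ τ hτ hip]
      rw [← e]
      ring
    · rw [Nat.choose_eq_zero_of_lt (by omega)]
      simp
  have hT : Polynomial.taylor (-τ⁻¹) F = ∑ p ∈ Finset.range (N + 1),
      Polynomial.C (a p / ((N - p).factorial : 𝕜) * τ ^ p) *
        ((Polynomial.X + Polynomial.C (-τ⁻¹)) ^ (N - p) * Polynomial.X ^ p) := by
    rw [map_sum]
    refine Finset.sum_congr rfl fun p _ => ?_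
    rw [Polynomial.taylor_mul, Polynomial.taylor_mul, Polynomial.taylor_pow, Polynomial.taylor_pow,
      map_add, Polynomial.taylor_X, Polynomial.taylor_C, Polynomial.taylor_C, add_assoc, ← map_add,
      neg_add_cancel, map_zero, add_zero, mul_comm (Polynomial.X ^ p)]
  rw [shift_congr fun q hq => hraise q (hq.trans hi), shift_factorial_mul_coeff F hi hdeg, hT,
    lower, Polynomial.eval_finsetSum, Polynomial.finsetSum_coeff, Finset.mul_sum]
  refine Finset.sum_congr rfl fun p hp => ?_
  rw [Finset.mem_range] at hp
  rw [Polynomial.eval_C_mul, Polynomial.eval_X_pow, Polynomial.coeff_C_mul,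
    Polynomial.coeff_mul_X_pow']
  by_cases hp2 : 2 * p < N
  · simp [ha p hp2]
  split_ifs with h
  · rw [Polynomial.coeff_X_add_C_pow, show N - i - p = N - p - i by omega,
      Nat.choose_symm (show i ≤ N - p by omega), Nat.sub_sub_self (show i ≤ N - p by omega)]
    have e : τ ^ p * (-τ⁻¹) ^ i = (-1) ^ i * τ ^ (p - i) := by
      rw [neg_pow, inv_pow, pow_sub₀ τ hτ (show i ≤ p by omega)]
      ring
    linear_combination ((N - i).factorial : 𝕜) * (a p / ((N - p).factorial : 𝕜)) *
      ((N - p).choose i : 𝕜) * e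
  · rw [Nat.choose_eq_zero_of_lt (show N - p < i by omega)]
    simp

theorem coeff_zero_lower {N i : ℕ} (hi : i ≤ N) {a : ℕ → 𝕜} (ha : ∀ p, 2 * p < N → a p = 0) :
    (lower N a i).coeff 0 = if 2 * i = N then (-1) ^ i * a i else 0 := by
  rw [lower, Polynomial.finsetSum_coeff, Finset.sum_eq_single i]
  · rw [Nat.sub_self, pow_zero, mul_one, Polynomial.coeff_C_zero]
    split_ifs with h
    · have h1 : ((N - i).factorial : 𝕜) ≠ 0 := by exact_mod_cast (N - i).factorial_ne_zero
      rw [show N - i = i by omega] at h1 ⊢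
      rw [Nat.choose_self]
      field_simp
      simp
    · rcases lt_or_gt_of_ne h with h | h
      · simp [ha i h]
      · rw [Nat.choose_eq_zero_of_lt (show N - i < i by omega)]
        simp
  · intro p hp hne
    rw [Finset.mem_range] at hp
    rw [Polynomial.coeff_C_mul_X_pow]
    split_ifs with h
    · by_cases hp2 : 2 * p < N
      · simp [ha p hp2]
      · rw [Nat.choose_eq_zero_of_lt (show N - p < i by omega)]
        simp
    · rfl
  · intro h
    exact absurd (Finset.mem_range.2 (by omega)) h

/-- If the lower halves of all blocks vanish, elements of `ker D` only see the middle coordinates,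
up to the action of the Weyl group. -/
theorem eval_eq_eval_middle {f : MvPolynomial (Σ j : Fin k, Fin (n j + 1)) 𝕜}
    (hf : Dw 𝕜 k n f = 0) {v : (Σ j : Fin k, Fin (n j + 1)) → 𝕜}
    (hv : ∀ j p, 2 * p < n j → coord v j p = 0) :
    eval v f = eval (fun x => if 2 * (x.2 : ℕ) = n x.1 then (-1) ^ (x.2 : ℕ) * v x else 0) f := by
  have h : aeval (fun x : Σ j : Fin k, Fin (n j + 1) => raise (n x.1) (coord v x.1) x.2) f
      = aeval (fun x : Σ j : Fin k, Fin (n j + 1) => lower (n x.1) (coord v x.1) x.2) f := by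
    refine Polynomial.eq_of_infinite_eval_eq _ _
      ((Set.finite_singleton (0 : 𝕜)).infinite_compl.mono fun τ hτ => ?_)
    rw [Set.mem_ofPred_eq, eval_aeval_polynomial, eval_aeval_polynomial,
      ← eval_shift hf (-τ⁻¹) (fun x => (raise (n x.1) (coord v x.1) x.2).eval τ)]
    congr 2
    funext x
    have hx := Nat.le_of_lt_succ x.2.2
    rw [← shift_eval_raise hx (hv x.1) hτ]
    exact shift_congr fun q hq => coord_of_le _ (hq.trans hx)
  have h0 := congrArg (Polynomial.eval 0) h
  rw [eval_aeval_polynomial, eval_aeval_polynomial] at h0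
  simp only [← Polynomial.coeff_zero_eq_eval_zero] at h0
  have hr : (fun x : Σ j : Fin k, Fin (n j + 1) => (raise (n x.1) (coord v x.1) x.2).coeff 0) = v := by
    funext x
    rw [coeff_zero_raise (Nat.le_of_lt_succ x.2.2), coord_fin]
  rw [hr] at h0
  rw [h0]
  congr 2
  funext x
  rw [coeff_zero_lower (Nat.le_of_lt_succ x.2.2) (hv x.1), coord_fin]

theorem coord_eq_zero_of_eval_fP {v : (Σ j : Fin k, Fin (n j + 1)) → 𝕜} {j : Fin k} {m : ℕ}
    (h : ∀ i < m, eval v (fP 𝕜 k n j i) = 0) : ∀ i < m, coord v j i = 0 := by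
  intro i
  induction i using Nat.strong_induction_on with
  | _ i ih =>
    intro hi
    rcases Nat.eq_zero_or_pos i with rfl | hpos
    · rw [← eval_fP_zero, h 0 hi]
    · have h1 := h i hi
      rw [eval_fP _ _ hpos.ne', quad, Finset.sum_eq_zero, zero_add] at h1
      · simpa using h1
      · intro q hq
        rw [Finset.mem_range] at hq
        rw [ih q hq (hq.trans hi), mul_zero, zero_mul]

theorem eval_eps_Xv (v : (Σ j : Fin k, Fin (n j + 1)) → 𝕜)
    (s : MvPolynomial (Σ j : Fin k, Fin (n j + 1)) 𝕜) {j : Fin k} {i : ℕ} (hi : i ≤ n j)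
    (hs : eval v (Dw 𝕜 k n s) ≠ 0) :
    eval v (eps 𝕜 k n s (Xv 𝕜 k n j i) i) = eval v (Dw 𝕜 k n s) ^ i *
      shift (-(eval v s / eval v (Dw 𝕜 k n s))) (coord v j) i := by
  rw [eps, map_sum, shift, Finset.mul_sum]
  refine Finset.sum_congr rfl fun q hq => ?_
  have hq : q ≤ i := Nat.le_of_lt_succ (Finset.mem_range.1 hq)
  rw [Dw_iterate_Xv hi hq, map_mul, map_mul, map_mul, eval_C, map_pow, map_pow,
    neg_pow (eval v s / eval v (Dw 𝕜 k n s)) q, div_pow, pow_sub₀ _ hs hq, coord]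
  field_simp

/-- Points with the same nonzero slice derivative and the same values `ε_s(x_{i,j})` are not
separated by `ker D`. -/
theorem eval_eq_of_eval_eps_eq {s f : MvPolynomial (Σ j : Fin k, Fin (n j + 1)) 𝕜}
    (hf : Dw 𝕜 k n f = 0) {v w : (Σ j : Fin k, Fin (n j + 1)) → 𝕜}
    (hs : eval v (Dw 𝕜 k n s) ≠ 0) (hvw : eval v (Dw 𝕜 k n s) = eval w (Dw 𝕜 k n s))
    (h : ∀ j i, i ≤ n j → (∃ q ≤ i, coord v j q ≠ 0 ∨ coord w j q ≠ 0) →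
      eval v (eps 𝕜 k n s (Xv 𝕜 k n j i) i) = eval w (eps 𝕜 k n s (Xv 𝕜 k n j i) i)) :
    eval v f = eval w f := by
  rw [← eval_shift hf (-(eval v s / eval v (Dw 𝕜 k n s))) v,
    ← eval_shift hf (-(eval w s / eval w (Dw 𝕜 k n s))) w]
  congr 2
  funext x
  have hx := Nat.le_of_lt_succ x.2.2
  by_cases hex : ∃ q ≤ (x.2 : ℕ), coord v x.1 q ≠ 0 ∨ coord w x.1 q ≠ 0
  · have := h x.1 x.2 hx hex
    rw [eval_eps_Xv v s hx hs, eval_eps_Xv w s hx (hvw ▸ hs), ← hvw] at this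
    rw [← hvw]
    exact mul_left_cancel₀ (pow_ne_zero _ hs) this
  · push Not at hex
    have h0 : ∀ s : 𝕜, shift s (fun _ => 0) (x.2 : ℕ) = 0 := fun s => by simp [shift]
    rw [shift_congr (c := fun _ => 0) fun q hq => (hex q hq).1,
      shift_congr (c := fun _ => 0) fun q hq => (hex q hq).2, h0, h0]

theorem mul_eq_mul_of_odd_pow {a b a' b' : 𝕜} {A B : ℕ} (hA : Odd A) (hB : Odd B)
    (ha : a ^ 2 = a' ^ 2) (hb : b ^ 2 = b' ^ 2) (h : a ^ A * b ^ B = a' ^ A * b' ^ B) :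
    a * b = a' * b' := by
  obtain ⟨c, rfl⟩ := hA
  obtain ⟨d, rfl⟩ := hB
  by_cases ha0 : a = 0
  · subst ha0
    have : a' = 0 := by simpa using ha.symm
    rw [this, zero_mul, zero_mul]
  by_cases hb0 : b = 0
  · subst hb0
    have : b' = 0 := by simpa using hb.symm
    rw [this, mul_zero, mul_zero]
  have e : (a ^ 2) ^ c * (b ^ 2) ^ d * (a * b) = (a ^ 2) ^ c * (b ^ 2) ^ d * (a' * b') := by
    conv_rhs => rw [ha, hb]
    simp only [← pow_mul]
    rw [pow_succ, pow_succ, pow_succ, pow_succ] at h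
    linear_combination h
  exact mul_left_cancel₀ (mul_ne_zero (pow_ne_zero _ (pow_ne_zero _ ha0))
    (pow_ne_zero _ (pow_ne_zero _ hb0))) e

theorem eq_of_sq_eq_of_cube_eq {a b : 𝕜} (h2 : a ^ 2 = b ^ 2) (h3 : a ^ 3 = b ^ 3) : a = b := by
  by_cases ha : a = 0
  · subst ha
    have : b = 0 := by simpa using h2.symm
    exact this.symm
  · refine mul_left_cancel₀ (pow_ne_zero 2 ha) ?_
    linear_combination h3 - b * h2

/-- A family of signs is determined up to a global sign by its pairwise products. -/
theorem forall_eq_or_forall_eq_neg {ι : Type*} {c d : ι → 𝕜} (hsq : ∀ i, c i ^ 2 = d i ^ 2)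
    (hmul : ∀ i j, i ≠ j → c i * c j = d i * d j) :
    (∀ i, d i = c i) ∨ (∀ i, d i = -c i) := by
  by_cases h : ∀ i, d i = c i
  · exact Or.inl h
  · push Not at h
    obtain ⟨i, hi⟩ := h
    have hi' : d i = -c i := (sq_eq_sq_iff_eq_or_eq_neg.1 (hsq i).symm).resolve_left hi
    have hc : c i ≠ 0 := fun h0 => hi (by rw [hi', h0, neg_zero])
    refine Or.inr fun j => ?_
    by_cases hj : i = j
    · rw [← hj, hi']
    · refine mul_left_cancel₀ hc ?_
      have := hmul i j hj
      rw [hi'] at this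
      linear_combination this

/-- The middle coordinate of a block, up to sign, is recovered from `f_{n_j/2,j}`. -/
theorem sq_coord_half_eq {v w : (Σ j : Fin k, Fin (n j + 1)) → 𝕜}
    (hv : ∀ j p, 2 * p < n j → coord v j p = 0) (hw : ∀ j p, 2 * p < n j → coord w j p = 0)
    {j : Fin k} (hj : Even (n j))
    (h : eval v (fP 𝕜 k n j (n j / 2)) = eval w (fP 𝕜 k n j (n j / 2))) :
    coord v j (n j / 2) ^ 2 = coord w j (n j / 2) ^ 2 := by
  obtain ⟨m, hm⟩ := hj
  have hm2 : n j / 2 = m := by omega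
  rw [hm2] at h ⊢
  rcases Nat.eq_zero_or_pos m with rfl | hpos
  · rw [eval_fP_zero, eval_fP_zero] at h
    rw [h]
  · rw [eval_fP _ _ hpos.ne', eval_fP _ _ hpos.ne', quad, quad, Finset.sum_eq_zero,
      Finset.sum_eq_zero, zero_add, zero_add] at h
    · refine mul_left_cancel₀ (a := (-1 : 𝕜) ^ m / 2) ?_ h
      exact div_ne_zero (pow_ne_zero _ (neg_ne_zero.2 one_ne_zero)) two_ne_zero
    · intro q hq
      rw [Finset.mem_range] at hq
      rw [hw j q (by omega), mul_zero, zero_mul]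
    · intro q hq
      rw [Finset.mem_range] at hq
      rw [hv j q (by omega), mul_zero, zero_mul]

/-- Points with vanishing lower halves whose middle coordinates differ by the Weyl group element,
or not at all, are not separated by `ker D`. -/
theorem eval_eq_of_middle {f : MvPolynomial (Σ j : Fin k, Fin (n j + 1)) 𝕜}
    (hf : Dw 𝕜 k n f = 0) {v w : (Σ j : Fin k, Fin (n j + 1)) → 𝕜}
    (hv : ∀ j p, 2 * p < n j → coord v j p = 0) (hw : ∀ j p, 2 * p < n j → coord w j p = 0)
    (h : (∀ j m, n j = 2 * m → coord w j m = coord v j m) ∨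
      ∀ j m, n j = 2 * m → coord w j m = (-1) ^ m * coord v j m) :
    eval v f = eval w f := by
  rcases h with h | h
  · rw [eval_eq_eval_middle hf hv, eval_eq_eval_middle hf hw]
    congr 2
    funext x
    split_ifs with hx
    · rw [← coord_fin v, ← coord_fin w, h _ _ hx.symm]
    · rfl
  · rw [eval_eq_eval_middle hf hw, eval_eq_eval_middle hf hv,
      eval_eq_eval_middle hf (v := fun x => if 2 * (x.2 : ℕ) = n x.1 then _ else _) ?_]
    · congr 2
      funext x
      split_ifs with hx
      · rw [← coord_fin v, ← coord_fin w, h _ _ hx.symm]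
      · rfl
    · intro j p hp
      rw [coord_of_le _ (by omega)]
      exact if_neg (by simp only; omega)

end

/- STATEMENT 1: the set `T` (six families of invariants) is a separating set for `ker D`. -/
theorem T_is_separating (𝕜 : Type) [Field 𝕜] [CharZero 𝕜] (k : ℕ) (hk : 2 ≤ k)
    (n : Fin k → ℕ) (l' l : ℕ) (hl'l : l' ≤ l) (hlk : l ≤ k)
    -- `n_j ≡ 2 (mod 4)` for `j < l'`
    (h2 : ∀ j : Fin k, (j : ℕ) < l' → n j % 4 = 2)
    -- `n_j ≡ 0 (mod 4)` for `l' ≤ j < l`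
    (h0 : ∀ j : Fin k, l' ≤ (j : ℕ) → (j : ℕ) < l → n j % 4 = 0)
    -- `n_j` odd for `l ≤ j`
    (hodd : ∀ j : Fin k, l ≤ (j : ℕ) → Odd (n j))
    (T : Set (MvPolynomial (Σ j : Fin k, Fin (n j + 1)) 𝕜))
    (hT : T =
      -- (1)  f_{i,j},  1 ≤ j ≤ k,  0 ≤ i ≤ ⌊n_j/2⌋
      {p | ∃ (j : Fin k) (i : ℕ), 2 * i ≤ n j ∧ p = fP 𝕜 k n j i} ∪
      -- (2)  ε_{s_{i₂,j₂}}(x_{i₁,j₁}),  j₁ < j₂,  ⌊(n_{j₁}-1)/2⌋ < i₁ ≤ n_{j₁},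
      --      0 ≤ i₂ ≤ ⌊(n_{j₂}-1)/2⌋  (note ν(x_{i₁,j₁}) = i₁)
      {p | ∃ (j1 j2 : Fin k) (i1 i2 : ℕ), j1 < j2 ∧ n j1 ≤ 2 * i1 ∧ i1 ≤ n j1 ∧
        2 * i2 + 1 ≤ n j2 ∧ p = eps 𝕜 k n (sP 𝕜 k n j2 i2) (Xv 𝕜 k n j1 i1) i1} ∪
      -- (3)  ε_{s_{i₂,j}}(x_{i₁,j}),  0 ≤ i₂ ≤ ⌊(n_j-1)/2⌋,  i₂ ≤ i₁ ≤ n_j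
      {p | ∃ (j : Fin k) (i1 i2 : ℕ), 2 * i2 + 1 ≤ n j ∧ i2 ≤ i1 ∧ i1 ≤ n j ∧
        p = eps 𝕜 k n (sP 𝕜 k n j i2) (Xv 𝕜 k n j i1) i1} ∪
      -- (4)  ε_{s_{i₂,j₂}}(x_{i₁,j₁}),  j₂ < j₁,  0 ≤ i₁ ≤ n_{j₁},  0 ≤ i₂ ≤ ⌊(n_{j₂}-1)/2⌋
      {p | ∃ (j1 j2 : Fin k) (i1 i2 : ℕ), j2 < j1 ∧ i1 ≤ n j1 ∧ 2 * i2 + 1 ≤ n j2 ∧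
        p = eps 𝕜 k n (sP 𝕜 k n j2 i2) (Xv 𝕜 k n j1 i1) i1} ∪
      -- (5)  w_{j₁,j₂},  1 ≤ j₁ ≠ j₂ ≤ l'
      {p | ∃ j1 j2 : Fin k, j1 ≠ j2 ∧ (j1 : ℕ) < l' ∧ (j2 : ℕ) < l' ∧ p = wP 𝕜 k n j1 j2} ∪
      -- (6)  z_j,  l' < j ≤ l
      {p | ∃ j : Fin k, l' ≤ (j : ℕ) ∧ (j : ℕ) < l ∧ p = zP 𝕜 k n j}) :
    -- `T ⊆ ker D` and `T` is a separating set for `ker D`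
    (∀ t ∈ T, Dw 𝕜 k n t = 0) ∧
    ∀ v w : (Σ j : Fin k, Fin (n j + 1)) → 𝕜,
      (∃ f, Dw 𝕜 k n f = 0 ∧ eval v f ≠ eval w f) →
      ∃ t ∈ T, eval v t ≠ eval w t := by
  subst hT
  refine ⟨?_, fun v w ⟨f, hf, hfvw⟩ => ?_⟩
  · rintro t (((((⟨j, i, hi, rfl⟩ | ⟨j₁, j₂, i₁, i₂, _, _, h₁, h₂, rfl⟩) |
      ⟨j, i₁, i₂, h₂, _, h₁, rfl⟩) | ⟨j₁, j₂, i₁, i₂, _, h₁, h₂, rfl⟩) |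
      ⟨j₁, j₂, _, _, _, rfl⟩) | ⟨j, hj, hj', rfl⟩)
    · exact Dw_fP hi
    · exact Dw_eps_sP_Xv h₁ h₂
    · exact Dw_eps_sP_Xv h₁ h₂
    · exact Dw_eps_sP_Xv h₁ h₂
    · exact Dw_wP
    · exact Dw_zP (h0 j hj hj')
  by_contra! hT
  refine hfvw ?_
  have hF : ∀ (j : Fin k) (i : ℕ), 2 * i ≤ n j →
      eval v (fP 𝕜 k n j i) = eval w (fP 𝕜 k n j i) := fun j i hi =>
    hT _ (Or.inl (Or.inl (Or.inl (Or.inl (Or.inl ⟨j, i, hi, rfl⟩)))))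
  by_cases hex : ∃ j i, 2 * i + 1 ≤ n j ∧ eval v (fP 𝕜 k n j i) ≠ 0
  · obtain ⟨j₂, hj₂, hjmin⟩ := WellFounded.has_min (wellFounded_lt (α := Fin k))
      {j | ∃ i, 2 * i + 1 ≤ n j ∧ eval v (fP 𝕜 k n j i) ≠ 0} hex
    classical
    obtain ⟨i₂, ⟨hi₂, hne⟩, himin⟩ : ∃ i, (2 * i + 1 ≤ n j₂ ∧ eval v (fP 𝕜 k n j₂ i) ≠ 0) ∧
        ∀ i' < i, ¬ (2 * i' + 1 ≤ n j₂ ∧ eval v (fP 𝕜 k n j₂ i') ≠ 0) :=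
      ⟨Nat.find hj₂, Nat.find_spec hj₂, fun i' hi' => Nat.find_min hj₂ hi'⟩
    have hlt : ∀ j₁ < j₂, ∀ i, 2 * i + 1 ≤ n j₁ → eval v (fP 𝕜 k n j₁ i) = 0 := by
      intro j₁ hj i hi
      by_contra h
      exact hjmin j₁ ⟨i, hi, h⟩ hj
    have heq : ∀ i < i₂, eval v (fP 𝕜 k n j₂ i) = 0 := by
      intro i hi
      by_contra h
      exact himin i hi ⟨by omega, h⟩
    refine eval_eq_of_eval_eps_eq (s := sP 𝕜 k n j₂ i₂) hf ?_ ?_ fun j₁ i₁ hi₁ hq => ?_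
    · rwa [Dw_sP hi₂]
    · rw [Dw_sP hi₂]
      exact hF _ _ (by omega)
    obtain ⟨q, hq, hne'⟩ := hq
    rcases lt_trichotomy j₁ j₂ with hj | rfl | hj
    · by_cases hn : n j₁ ≤ 2 * i₁
      · exact hT _ (Or.inl (Or.inl (Or.inl (Or.inl (Or.inr
          ⟨j₁, j₂, i₁, i₂, hj, hn, hi₁, hi₂, rfl⟩)))))
      · exfalso
        rcases hne' with hne' | hne'
        · exact hne' (coord_eq_zero_of_eval_fP (m := i₁ + 1)
            (fun i hi => hlt _ hj i (by omega)) q (by omega))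
        · exact hne' (coord_eq_zero_of_eval_fP (m := i₁ + 1)
            (fun i hi => by rw [← hF j₁ i (by omega), hlt j₁ hj i (by omega)]) q (by omega))
    · by_cases hn : i₂ ≤ i₁
      · exact hT _ (Or.inl (Or.inl (Or.inl (Or.inr ⟨j₁, i₁, i₂, hi₂, hn, hi₁, rfl⟩))))
      · exfalso
        rcases hne' with hne' | hne'
        · exact hne' (coord_eq_zero_of_eval_fP heq q (by omega))
        · exact hne' (coord_eq_zero_of_eval_fP (m := i₂)
            (fun i hi => by rw [← hF j₁ i (by omega), heq i hi]) q (by omega))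
    · exact hT _ (Or.inl (Or.inl (Or.inr ⟨j₁, j₂, i₁, i₂, hj, hi₁, hi₂, rfl⟩)))
  · push Not at hex
    have hv : ∀ j p, 2 * p < n j → coord v j p = 0 := fun j p hp =>
      coord_eq_zero_of_eval_fP (m := p + 1) (fun i hi => hex j i (by omega)) p (by omega)
    have hw : ∀ j p, 2 * p < n j → coord w j p = 0 := fun j p hp =>
      coord_eq_zero_of_eval_fP (m := p + 1)
        (fun i hi => by rw [← hF j i (by omega), hex j i (by omega)]) p (by omega)
    have hsq : ∀ j, Even (n j) → coord v j (n j / 2) ^ 2 = coord w j (n j / 2) ^ 2 := fun j hj =>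
      sq_coord_half_eq hv hw hj (hF _ _ (by omega))
    have hz : ∀ j : Fin k, l' ≤ (j : ℕ) → (j : ℕ) < l →
        coord w j (n j / 2) = coord v j (n j / 2) := by
      intro j hj hj'
      have hmod := h0 j hj hj'
      by_cases hn : n j = 0
      · have := hF j 0 (by omega)
        rw [eval_fP_zero, eval_fP_zero] at this
        rw [hn, this]
      · obtain ⟨κ, hκ, hκz⟩ := exists_eval_zP (𝕜 := 𝕜) hmod hn
        have := hT _ (Or.inr ⟨j, hj, hj', rfl⟩)
        rw [hκz v (hv j), hκz w (hw j)] at this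
        exact (eq_of_sq_eq_of_cube_eq (hsq j (Nat.even_iff.2 (by omega)))
          (mul_left_cancel₀ hκ this)).symm
    have hsign : (∀ j : {j : Fin k // (j : ℕ) < l'}, coord w j (n j / 2) = coord v j (n j / 2)) ∨
        ∀ j : {j : Fin k // (j : ℕ) < l'}, coord w j (n j / 2) = -coord v j (n j / 2) := by
      have heven : ∀ j : {j : Fin k // (j : ℕ) < l'}, Even (n j) := fun j =>
        Nat.even_iff.2 (by have := h2 j j.2; omega)
      refine forall_eq_or_forall_eq_neg (fun j => hsq j (heven j)) fun i j hij => ?_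
      obtain ⟨κ, hκ, hκw⟩ := exists_eval_wP (𝕜 := 𝕜) (h2 i i.2) (h2 j j.2)
      have := hT _ (Or.inl (Or.inr ⟨i, j, fun h => hij (Subtype.ext h), i.2, j.2, rfl⟩))
      rw [hκw v hv, hκw w hw] at this
      refine mul_eq_mul_of_odd_pow (odd_lcm_div_left (h2 i i.2) (h2 j j.2)) ?_
        (hsq i (heven i)) (hsq j (heven j)) (mul_left_cancel₀ hκ this)
      rw [Nat.lcm_comm]
      exact odd_lcm_div_left (h2 j j.2) (h2 i i.2)
    have hcases : ∀ j : Fin k, ∀ m, n j = 2 * m → n j / 2 = m ∧ ((j : ℕ) < l' ∨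
        (Even m ∧ coord w j (n j / 2) = coord v j (n j / 2))) := by
      intro j m hm
      refine ⟨by omega, ?_⟩
      by_cases hj : (j : ℕ) < l'
      · exact Or.inl hj
      · by_cases hj' : (j : ℕ) < l
        · have := h0 j (by omega) hj'
          exact Or.inr ⟨Nat.even_iff.2 (by omega), hz j (by omega) hj'⟩
        · have := Nat.odd_iff.1 (hodd j (by omega))
          omega
    refine eval_eq_of_middle hf hv hw (hsign.imp (fun h j m hm => ?_) fun h j m hm => ?_)
    · obtain ⟨rfl, hj | ⟨-, hj⟩⟩ := hcases j m hm
      · exact h ⟨j, hj⟩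
      · exact hj
    · obtain ⟨rfl, hj | ⟨he, hj⟩⟩ := hcases j m hm
      · have := h2 j hj
        rw [Odd.neg_one_pow (Nat.odd_iff.2 (by omega)), neg_one_mul]
        exact h ⟨j, hj⟩
      · rw [he.neg_one_pow, one_mul, hj]
end

section
/- Let σ be the 𝕜-algebra automorphism of R′ of order two with σ(x_{0,j}) = −x_{0,j} for 1 ≤ j ≤ l′ (the indices with n_j ≡ 2 (mod 4)) and σ fixing all other variables. Then for every f ∈ ker D, the image Π*(f) is fixed by σ; that is, Π*(ker D) is contained in the ring of invariants of the cyclic group of order two acting on 𝕜[x_{0,j} : 1 ≤ j ≤ l] by multiplication by −1 on x_{0,j} for 1 ≤ j ≤ l′ and trivially on the remaining variables. -/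
/- STATEMENT 3: `Π*(ker D)` is fixed by the order-two automorphism `σ` of `R'`
(multiplication by `-1` on `x_{0,j}` for `j ≤ l'`, fixing all other variables). -/

open MvPolynomial Finset

variable (𝕜 : Type) [Field 𝕜] [CharZero 𝕜] (k : ℕ) (n : Fin k → ℕ)

/-- The variable `x_{i,j}` of `R' = 𝕜[x_{i,j} : 0 ≤ i ≤ ⌊n_j/2⌋]`, or `0` if out of range. -/
noncomputable def Xv' (j : Fin k) (i : ℕ) : MvPolynomial (Σ j : Fin k, Fin (n j / 2 + 1)) 𝕜 :=
  if h : i ≤ n j / 2 then MvPolynomial.X ⟨j, ⟨i, Nat.lt_succ_of_le h⟩⟩ else 0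

/-- The projection `Π* : R → R'`, sending `x_{i,j}` to `x_{i - ⌈n_j/2⌉, j}` if
`i ≥ ⌈n_j/2⌉` and to `0` otherwise. -/
noncomputable def projStar : MvPolynomial (Σ j : Fin k, Fin (n j + 1)) 𝕜 →ₐ[𝕜]
    MvPolynomial (Σ j : Fin k, Fin (n j / 2 + 1)) 𝕜 :=
  aeval fun v => if (n v.1 + 1) / 2 ≤ (v.2 : ℕ) then Xv' 𝕜 k n v.1 ((v.2 : ℕ) - (n v.1 + 1) / 2)
    else 0

/-- The algebra automorphism `σ` of `R'` with `σ(x_{0,j}) = -x_{0,j}` for `j ≤ l'` and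
fixing all the other variables. -/
noncomputable def sigmaAut (l' : ℕ) : MvPolynomial (Σ j : Fin k, Fin (n j / 2 + 1)) 𝕜 →ₐ[𝕜]
    MvPolynomial (Σ j : Fin k, Fin (n j / 2 + 1)) 𝕜 :=
  aeval fun v => if (v.1 : ℕ) < l' ∧ (v.2 : ℕ) = 0 then -MvPolynomial.X v else MvPolynomial.X v

/-- The member with parameter `ε` of a family of polynomials of degree at most `d` deforming
`∑ a_m z^m`, where `m ≤ d / 2`. -/
noncomputable def degeneration {S : Type*} [CommRing S] (d : ℕ) (a : ℕ → S) (ε : S) :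
    Polynomial S :=
  ∑ m ∈ range (d / 2 + 1), Polynomial.C (a m) *
    (Polynomial.X ^ m * (1 - Polynomial.C ε * Polynomial.X) ^ (d - m) +
      if 2 * m < d then (-1) ^ m * Polynomial.C ε ^ (d - 2 * m) * Polynomial.X ^ (d - m) *
        (1 - Polynomial.C ε * Polynomial.X) ^ m else 0)

/-- The translate of `degeneration d a ε` by `ε⁻¹`, written without denominators. -/
noncomputable def degenerationTranslate {S : Type*} [CommRing S] (d : ℕ) (a : ℕ → S) (ε : S) :
    Polynomial S :=
  ∑ m ∈ range (d / 2 + 1), Polynomial.C (a m) *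
    ((-1) ^ (d - m) * Polynomial.C ε ^ (d - 2 * m) * Polynomial.X ^ (d - m) *
        (1 + Polynomial.C ε * Polynomial.X) ^ m +
      if 2 * m < d then Polynomial.X ^ m * (1 + Polynomial.C ε * Polynomial.X) ^ (d - m) else 0)

theorem degeneration_map {S T : Type*} [CommRing S] [CommRing T] (g : S →+* T) (d : ℕ)
    (a : ℕ → S) (ε : S) :
    (degeneration d a ε).map g = degeneration d (fun m => g (a m)) (g ε) := by
  simp only [degeneration, Polynomial.map_sum]
  refine Finset.sum_congr rfl fun m _ => ?_
  split_ifs <;> simp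

theorem degenerationTranslate_map {S T : Type*} [CommRing S] [CommRing T] (g : S →+* T) (d : ℕ)
    (a : ℕ → S) (ε : S) :
    (degenerationTranslate d a ε).map g =
      degenerationTranslate d (fun m => g (a m)) (g ε) := by
  simp only [degenerationTranslate, Polynomial.map_sum]
  refine Finset.sum_congr rfl fun m _ => ?_
  split_ifs <;> simp

theorem natDegree_degeneration_le {S : Type*} [CommRing S] (d : ℕ) (a : ℕ → S) (ε : S) :
    (degeneration d a ε).natDegree ≤ d := by
  refine Polynomial.natDegree_sum_le_of_forall_le _ _ fun m hm => ?_
  have hm : m ≤ d / 2 := by simpa [Nat.lt_succ_iff] using hm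
  have h1 : (1 - Polynomial.C ε * Polynomial.X : Polynomial S).natDegree ≤ 1 := by
    compute_degree
  have hX (r : ℕ) : (Polynomial.X ^ r : Polynomial S).natDegree ≤ r := by compute_degree
  have hp (r : ℕ) : ((1 - Polynomial.C ε * Polynomial.X : Polynomial S) ^ r).natDegree ≤ r := by
    simpa using Polynomial.natDegree_pow_le_of_le r h1
  refine Polynomial.natDegree_C_mul_le _ _ |>.trans (Polynomial.natDegree_add_le_of_degree_le ?_ ?_)
  · exact (Polynomial.natDegree_mul_le_of_le (hX m) (hp (d - m))).trans (by omega)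
  · split_ifs
    · have hc : ((-1) ^ m * Polynomial.C ε ^ (d - 2 * m) : Polynomial S).natDegree ≤ 0 := by
        have : ((-1) ^ m * Polynomial.C ε ^ (d - 2 * m) : Polynomial S) =
            Polynomial.C ((-1) ^ m * ε ^ (d - 2 * m)) := by simp
        rw [this, Polynomial.natDegree_C]
      exact (Polynomial.natDegree_mul_le_of_le
        (Polynomial.natDegree_mul_le_of_le hc (hX (d - m))) (hp m)).trans (by omega)
    · simp

theorem degeneration_comp {K : Type*} [Field K] (d : ℕ) (a : ℕ → K) {ε : K} (hε : ε ≠ 0) :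
    (degeneration d a ε).comp (Polynomial.X + Polynomial.C ε⁻¹) =
      degenerationTranslate d a ε := by
  simp only [degeneration, degenerationTranslate, Polynomial.sum_comp]
  refine Finset.sum_congr rfl fun m hm => ?_
  have hm : m ≤ d / 2 := by simpa [Nat.lt_succ_iff] using hm
  obtain ⟨r, rfl⟩ : ∃ r, d = 2 * m + r := ⟨d - 2 * m, by omega⟩
  have e1 : 2 * m + r - m = m + r := by omega
  have e2 : 2 * m + r - 2 * m = r := by omega
  rw [e1, e2]
  have hc : Polynomial.C ε * Polynomial.C ε⁻¹ = (1 : Polynomial K) := by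
    rw [← Polynomial.C_mul, mul_inv_cancel₀ hε, Polynomial.C_1]
  generalize hE : Polynomial.C ε = E at *
  generalize Polynomial.C ε⁻¹ = t at *
  have h1 : 1 - E * (Polynomial.X + t) = (-1) * E * Polynomial.X := by
    linear_combination -hc
  have h2 : 1 + E * Polynomial.X = E * (Polynomial.X + t) := by linear_combination -hc
  have h3 (p : Polynomial K) : E.comp p = E := by rw [← hE, Polynomial.C_comp]
  have h4 : ((-1 : Polynomial K) ^ m) * (-1) ^ m = 1 := by rw [← mul_pow]; simp
  split_ifs
  · simp only [Polynomial.mul_comp, Polynomial.add_comp, Polynomial.sub_comp, Polynomial.pow_comp,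
      Polynomial.neg_comp, Polynomial.one_comp, Polynomial.X_comp, Polynomial.C_comp, h3, h1]
    rw [h2]
    congr 1
    simp only [mul_pow, pow_add]
    linear_combination E ^ m * E ^ r * Polynomial.X ^ m * (Polynomial.X + t) ^ m *
      (Polynomial.X + t) ^ r * h4
  · simp only [Polynomial.mul_comp, Polynomial.add_comp, Polynomial.sub_comp, Polynomial.pow_comp,
      Polynomial.one_comp, Polynomial.X_comp, Polynomial.C_comp, h3, h1, Polynomial.zero_comp]
    rw [h2]
    simp only [mul_pow, pow_add]
    ring

theorem coeff_degeneration_zero {S : Type*} [CommRing S] (d : ℕ) (a : ℕ → S) (i : ℕ) :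
    (degeneration d a 0).coeff i = if i ≤ d / 2 then a i else 0 := by
  have h (m : ℕ) : (if 2 * m < d then (-1) ^ m * (0 : Polynomial S) ^ (d - 2 * m) *
      Polynomial.X ^ (d - m) else 0) = 0 := by
    split_ifs with hm
    · simp [zero_pow (show d - 2 * m ≠ 0 by omega)]
    · rfl
  simp [degeneration, h, Polynomial.coeff_X_pow]

theorem coeff_degenerationTranslate_zero {S : Type*} [CommRing S] (d : ℕ) (a : ℕ → S) (i : ℕ) :
    (degenerationTranslate d a 0).coeff i =
      if i ≤ d / 2 then (if 2 * i < d then a i else (-1) ^ i * a i) else 0 := by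
  have h (m : ℕ) (hm : m ∈ range (d / 2 + 1)) :
      (Polynomial.C (a m) *
        ((-1) ^ (d - m) * Polynomial.C 0 ^ (d - 2 * m) * Polynomial.X ^ (d - m) *
          (1 + Polynomial.C 0 * Polynomial.X) ^ m +
        if 2 * m < d then Polynomial.X ^ m * (1 + Polynomial.C 0 * Polynomial.X) ^ (d - m)
          else 0)).coeff i =
      if i = m then (if 2 * i < d then a i else (-1) ^ i * a i) else 0 := by
    have hm : m ≤ d / 2 := by simpa [Nat.lt_succ_iff] using hm
    split_ifs with h1 h2 h3 h2 <;> try omega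
    · subst h2
      simp [zero_pow (show d - 2 * i ≠ 0 by omega)]
    · simp [zero_pow (show d - 2 * m ≠ 0 by omega), Polynomial.coeff_X_pow, h2]
    · subst h2
      have e : (-1 : Polynomial S) ^ (d - i) = Polynomial.C ((-1) ^ i) := by
        rw [show d - i = i by omega]; simp
      rw [e, show d - 2 * i = 0 by omega, show d - i = i by omega]
      simp only [pow_zero, mul_one, map_zero, zero_mul, add_zero, one_pow, Polynomial.coeff_C_mul,
        Polynomial.coeff_X_pow, if_true]
      ring
    · have e : (-1 : Polynomial S) ^ (d - m) = Polynomial.C ((-1) ^ (d - m)) := by simp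
      rw [e, show d - 2 * m = 0 by omega]
      simp only [pow_zero, mul_one, map_zero, zero_mul, add_zero, one_pow, Polynomial.coeff_C_mul,
        Polynomial.coeff_X_pow, show i ≠ d - m by omega, if_false, mul_zero]
  rw [degenerationTranslate, Polynomial.finsetSum_coeff, Finset.sum_congr rfl h]
  simp

/-- Evaluation of `R` at the point whose coordinate `x_{i,j}` is the `(n_j - i)`-th derivative of
`F j` at `0`; translating the `F j` is the `𝔾_a`-action. -/
noncomputable def evalDerivs {B : Type*} [CommRing B] [Algebra 𝕜 B] (F : Fin k → Polynomial B) :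
    MvPolynomial (Σ j : Fin k, Fin (n j + 1)) 𝕜 →ₐ[𝕜] B :=
  aeval fun v => (Polynomial.derivative^[n v.1 - v.2] (F v.1)).eval 0

theorem map_evalDerivs {B B' : Type*} [CommRing B] [Algebra 𝕜 B] [CommRing B'] [Algebra 𝕜 B']
    (g : B →ₐ[𝕜] B') (F : Fin k → Polynomial B)
    (f : MvPolynomial (Σ j : Fin k, Fin (n j + 1)) 𝕜) :
    g (evalDerivs 𝕜 k n F f) = evalDerivs 𝕜 k n (fun j => (F j).map (g : B →+* B')) f := by
  suffices h : g.comp (evalDerivs 𝕜 k n F) =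
      evalDerivs 𝕜 k n (fun j => (F j).map (g : B →+* B')) from DFunLike.congr_fun h f
  ext v
  simp [evalDerivs, Polynomial.iterate_derivative_map]

theorem iterate_derivative_comp_X_add_C {B : Type*} [CommRing B] (p : Polynomial B) (s : B)
    (r : ℕ) :
    Polynomial.derivative^[r] (p.comp (Polynomial.X + Polynomial.C s)) =
      (Polynomial.derivative^[r] p).comp (Polynomial.X + Polynomial.C s) := by
  induction r with
  | zero => rfl
  | succ r ih => simp [Function.iterate_succ_apply', ih, Polynomial.derivative_comp,
      -Function.iterate_succ]

theorem evalDerivs_comp_X_add_C {B : Type*} [CommRing B] [IsDomain B] [CharZero B] [Algebra 𝕜 B]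
    (F : Fin k → Polynomial B) (hF : ∀ j, (F j).natDegree ≤ n j) (t : B)
    {f : MvPolynomial (Σ j : Fin k, Fin (n j + 1)) 𝕜} (hf : Dw 𝕜 k n f = 0) :
    evalDerivs 𝕜 k n (fun j => (F j).comp (Polynomial.X + Polynomial.C t)) f =
      evalDerivs 𝕜 k n F f := by
  let ψ : MvPolynomial (Σ j : Fin k, Fin (n j + 1)) 𝕜 →ₐ[𝕜] Polynomial B :=
    aeval fun v => Polynomial.derivative^[n v.1 - v.2] (F v.1)
  have hψ (s : B) (p : MvPolynomial (Σ j : Fin k, Fin (n j + 1)) 𝕜) :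
      evalDerivs 𝕜 k n (fun j => (F j).comp (Polynomial.X + Polynomial.C s)) p =
        (ψ p).eval s := by
    induction p using MvPolynomial.induction_on with
    | C c => simp [ψ, evalDerivs, Polynomial.algebraMap_apply]
    | add p q hp hq => simp [hp, hq]
    | mul_X p v hp =>
      have hX : evalDerivs 𝕜 k n (fun j => (F j).comp (Polynomial.X + Polynomial.C s)) (X v) =
          (ψ (X v)).eval s := by
        simp [ψ, evalDerivs, iterate_derivative_comp_X_add_C]
      rw [map_mul, map_mul, Polynomial.eval_mul, hp, hX]
  have hD (p : MvPolynomial (Σ j : Fin k, Fin (n j + 1)) 𝕜) :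
      Polynomial.derivative (ψ p) = ψ (Dw 𝕜 k n p) := by
    induction p using MvPolynomial.induction_on with
    | C c => simp [ψ, Polynomial.algebraMap_apply]
    | add p q hp hq => simp [hp, hq]
    | mul_X p v hp =>
      have hX : Polynomial.derivative (ψ (X v)) = ψ (Dw 𝕜 k n (X v)) := by
        obtain ⟨j, i, hi⟩ := v
        simp only [Dw, mkDerivation_X]
        split_ifs with h
        · subst h
          simp only [ψ, aeval_X, map_zero, ← Function.iterate_succ_apply']
          exact Polynomial.iterate_derivative_eq_zero (by have := hF j; simp; omega)
        · simp only [Xv, show i - 1 ≤ n j by omega, dite_true, ψ, aeval_X,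
            ← Function.iterate_succ_apply']
          congr 2
          omega
      simp only [map_mul, Polynomial.derivative_mul, hp, hX, Derivation.leibniz, map_add,
        smul_eq_mul]
      ring
  have hconst := Polynomial.derivative_eq_zero.mp
    (show Polynomial.derivative (ψ f) = 0 by rw [hD, hf, map_zero])
  obtain ⟨c, hc⟩ := Polynomial.natDegree_eq_zero.mp hconst
  have h0 := hψ 0 f
  simp only [map_zero, add_zero, Polynomial.comp_X] at h0
  rw [hψ, h0, ← hc, Polynomial.eval_C, Polynomial.eval_C]

theorem evalDerivs_degeneration {B : Type*} [CommRing B] [IsDomain B] [Algebra 𝕜 B]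
    (a : Fin k → ℕ → B) {f : MvPolynomial (Σ j : Fin k, Fin (n j + 1)) 𝕜}
    (hf : Dw 𝕜 k n f = 0) :
    evalDerivs 𝕜 k n (fun j => degeneration (n j) (a j) 0) f =
      evalDerivs 𝕜 k n (fun j => degenerationTranslate (n j) (a j) 0) f := by
  let ι := IsScalarTower.toAlgHom 𝕜 (Polynomial B) (FractionRing (Polynomial B))
  have hι : Function.Injective ι := IsFractionRing.injective _ _
  have : CharZero (FractionRing (Polynomial B)) :=
    charZero_of_injective_algebraMap (algebraMap 𝕜 _).injective
  have hε : ι Polynomial.X ≠ 0 := by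
    rw [Ne, map_eq_zero_iff ι hι]
    exact Polynomial.X_ne_zero
  have key : evalDerivs 𝕜 k n
        (fun j => degeneration (n j) (fun m => Polynomial.C (a j m)) Polynomial.X) f =
      evalDerivs 𝕜 k n
        (fun j => degenerationTranslate (n j) (fun m => Polynomial.C (a j m)) Polynomial.X) f := by
    apply hι
    rw [map_evalDerivs, map_evalDerivs]
    simp only [degeneration_map, degenerationTranslate_map, RingHom.coe_coe]
    rw [← evalDerivs_comp_X_add_C 𝕜 k n _ (fun j => natDegree_degeneration_le _ _ _)
      (ι Polynomial.X)⁻¹ hf]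
    simp only [degeneration_comp _ _ hε]
  let g : Polynomial B →ₐ[𝕜] B := (Polynomial.aeval (0 : B)).restrictScalars 𝕜
  have := congrArg g key
  rw [map_evalDerivs, map_evalDerivs] at this
  simpa [degeneration_map, degenerationTranslate_map, g] using this

theorem evalDerivs_X {B : Type*} [CommRing B] [Algebra 𝕜 B] (F : Fin k → Polynomial B)
    (v : Σ j : Fin k, Fin (n j + 1)) :
    evalDerivs 𝕜 k n F (X v) = (n v.1 - v.2).factorial * (F v.1).coeff (n v.1 - v.2) := by
  simp [evalDerivs, ← Polynomial.coeff_zero_eq_eval_zero, Polynomial.coeff_iterate_derivative,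
    Nat.descFactorial_self]

theorem projStar_image_fixed_by_sigma (𝕜 : Type) [Field 𝕜] [CharZero 𝕜] (k : ℕ) (hk : 1 ≤ k)
    (n : Fin k → ℕ) (l' l : ℕ) (hl'l : l' ≤ l) (hlk : l ≤ k)
    (h2 : ∀ j : Fin k, (j : ℕ) < l' → n j % 4 = 2)
    (h0 : ∀ j : Fin k, l' ≤ (j : ℕ) → (j : ℕ) < l → n j % 4 = 0)
    (hodd : ∀ j : Fin k, l ≤ (j : ℕ) → Odd (n j))
    (f : MvPolynomial (Σ j : Fin k, Fin (n j + 1)) 𝕜) (hf : Dw 𝕜 k n f = 0) :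
    sigmaAut 𝕜 k n l' (projStar 𝕜 k n f) = projStar 𝕜 k n f := by
  let a : Fin k → ℕ → MvPolynomial (Σ j : Fin k, Fin (n j / 2 + 1)) 𝕜 := fun j m =>
    C ((m.factorial : 𝕜)⁻¹) * Xv' 𝕜 k n j (n j / 2 - m)
  have ha (j : Fin k) (m : ℕ) : (m.factorial : MvPolynomial (Σ j : Fin k, Fin (n j / 2 + 1)) 𝕜) *
      a j m = Xv' 𝕜 k n j (n j / 2 - m) := by
    have h : (m.factorial : MvPolynomial (Σ j : Fin k, Fin (n j / 2 + 1)) 𝕜) =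
        C (m.factorial : 𝕜) := by simp
    rw [h, ← mul_assoc, ← C_mul, mul_inv_cancel₀ (by exact_mod_cast m.factorial_ne_zero), C_1,
      one_mul]
  have hproj : projStar 𝕜 k n = evalDerivs 𝕜 k n (fun j => degeneration (n j) (a j) 0) := by
    ext1 v
    obtain ⟨j, i, hi⟩ := v
    rw [evalDerivs_X, coeff_degeneration_zero]
    simp only [projStar, aeval_X]
    split_ifs <;> try omega
    · rw [ha]
      congr 1
      omega
    · simp
  have hsigma : (sigmaAut 𝕜 k n l').comp (projStar 𝕜 k n) =
      evalDerivs 𝕜 k n (fun j => degenerationTranslate (n j) (a j) 0) := by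
    ext1 v
    obtain ⟨j, i, hi⟩ := v
    rw [evalDerivs_X, coeff_degenerationTranslate_zero]
    simp only [projStar, AlgHom.comp_apply, aeval_X]
    by_cases h1 : (n j + 1) / 2 ≤ i
    · rw [if_pos h1, if_pos (show n j - i ≤ n j / 2 by omega)]
      have hX : Xv' 𝕜 k n j (n j / 2 - (n j - i)) = X ⟨j, ⟨i - (n j + 1) / 2, by omega⟩⟩ := by
        rw [Xv', dif_pos (by omega)]
        congr 3
        omega
      have hX' : Xv' 𝕜 k n j (i - (n j + 1) / 2) = X ⟨j, ⟨i - (n j + 1) / 2, by omega⟩⟩ := by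
        rw [Xv', dif_pos (by omega)]
      rw [hX', sigmaAut, aeval_X]
      split_ifs with h3 h4 h4
      · have := h2 j h3.1
        dsimp only at h3
        omega
      · have := h2 j h3.1
        dsimp only at h3
        have hodd' : Odd (n j - i) := by rw [Nat.odd_iff]; omega
        rw [hodd'.neg_one_pow, mul_left_comm, ha, hX, neg_one_mul]
      · rw [ha, hX]
      · have hl : ¬ (j : ℕ) < l' := fun h => h3 ⟨h, by dsimp only; omega⟩
        have hlt : (j : ℕ) < l := by
          by_contra h
          have := Nat.odd_iff.mp (hodd j (by omega))
          omega
        have := h0 j (by omega) hlt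
        have heven : Even (n j - i) := by rw [Nat.even_iff]; omega
        rw [heven.neg_one_pow, one_mul, ha, hX]
    · rw [if_neg h1, if_neg (by omega)]
      simp
  rw [← AlgHom.comp_apply, hsigma, hproj]
  exact (evalDerivs_degeneration 𝕜 k n a hf).symm
end
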